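/- Fix α > 0 and t > 0. As n → ∞ the following asymptotics hold: α_n(t) = 2n + α + 1 + (t^{2/3}/2^{1/3}) n^{−1/3} + O(n^{−2/3}); β_n(t) = n² + αn + 2^{−4/3} t^{2/3} n^{2/3} + O(n^{1/3}); and H_n(t) = −(3/4)(2t)^{2/3} n^{2/3} + O(n^{1/3}). That is, there exist C > 0 and N ∈ ℕ such that for all n ≥ N: |α_n(t) − (2n + α + 1) − (t^{2/3}/2^{1/3}) n^{−1/3}| ≤ C n^{−2/3}, |β_n(t) − n² − αn − 2^{−4/3} t^{2/3} n^{2/3}| ≤ C n^{1/3}, and |H_n(t) + (3/4)(2t)^{2/3} n^{2/3}| ≤ C n^{1/3}. -/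

import Mathlib

open MeasureTheory Set

/-- The singularly perturbed Laguerre weight `w(x; t, α) = x^α e^{-x - t/x}`. -/
noncomputable def pertLagWeight (α t x : ℝ) : ℝ := x ^ α * Real.exp (-x - t / x)

/-- The `j`-th moment `μ_j(t) = ∫_0^∞ x^j w(x; t, α) dx`. -/
noncomputable def pertLagMoment (α t : ℝ) (j : ℕ) : ℝ :=
  ∫ x in Set.Ioi (0:ℝ), x ^ j * pertLagWeight α t x

/-- The Hankel determinant `D_n[w; t] = det(μ_{j+k}(t))_{j,k=0}^{n-1}`. -/
noncomputable def hankelDet (α : ℝ) (n : ℕ) (t : ℝ) : ℝ :=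
  (Matrix.of (fun j k : Fin n => pertLagMoment α t (j.1 + k.1))).det

/-- `H_n(t) = t (d/dt) ln D_n[w; t]`. -/
noncomputable def Hlog (α : ℝ) (n : ℕ) (t : ℝ) : ℝ :=
  t * deriv (fun τ => Real.log (hankelDet α n τ)) t

/-- The class of functions whose symmetric average over `s ± 1/2` exceeds the value at `s` by a
relative error of at most `2 / s ^ 2`. -/
def AlmostMidconcave (F : ℝ → ℝ) : Prop :=
  ∀ s : ℝ, 1 ≤ s → F (s - 1 / 2) + F (s + 1 / 2) ≤ 2 * (1 + 2 / s ^ 2) * F s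

theorem AlmostMidconcave.add {F G : ℝ → ℝ} (hF : AlmostMidconcave F) (hG : AlmostMidconcave G) :
    AlmostMidconcave (fun s => F s + G s) := fun s hs => by
  have h1 := hF s hs
  have h2 := hG s hs
  simp only
  linarith

theorem AlmostMidconcave.const_mul {F : ℝ → ℝ} (hF : AlmostMidconcave F) {c : ℝ} (hc : 0 ≤ c) :
    AlmostMidconcave (fun s => c * F s) := fun s hs => by
  have h1 := mul_le_mul_of_nonneg_left (hF s hs) hc
  simp only
  linarith

theorem rpow_le_weighted_sq {p y : ℝ} (hp : |p| ≤ 2) (hy : 0 < y) :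
    y ^ p ≤ (2 - p) / 4 * (y ^ 2)⁻¹ + (2 + p) / 4 * y ^ 2 := by
  obtain ⟨h1, h2⟩ := abs_le.mp hp
  have := Real.geom_mean_le_arith_mean2_weighted (w₁ := (2 - p) / 4) (w₂ := (2 + p) / 4)
    (p₁ := (y ^ 2)⁻¹) (p₂ := y ^ 2) (by linarith) (by linarith) (by positivity) (by positivity)
    (by ring)
  refine le_trans (le_of_eq ?_) this
  rw [← Real.rpow_natCast, ← Real.rpow_neg hy.le, ← Real.rpow_mul hy.le, ← Real.rpow_mul hy.le,
    ← Real.rpow_add hy]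
  congr 1
  push_cast
  ring

theorem AlmostMidconcave.rpow {p : ℝ} (hp : |p| ≤ 2) : AlmostMidconcave (fun s => s ^ p) := by
  intro s hs
  have hs0 : 0 < s := by linarith
  set x := 1 / (2 * s) with hx
  have hx0 : 0 < x := by positivity
  have hx1 : x ≤ 1 / 2 := by
    rw [hx, div_le_div_iff₀ (by positivity) (by norm_num)]; linarith
  have e1 : s - 1 / 2 = s * (1 - x) := by rw [hx]; field_simp
  have e2 : s + 1 / 2 = s * (1 + x) := by rw [hx]; field_simp
  have e3 : 2 / s ^ 2 = 8 * x ^ 2 := by rw [hx]; field_simp; norm_num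
  obtain ⟨hp1, hp2⟩ := abs_le.mp hp
  have key : (1 - x) ^ p + (1 + x) ^ p ≤ 2 * (1 + 8 * x ^ 2) := by
    have w1 := rpow_le_weighted_sq hp (show 0 < 1 - x by linarith)
    have w2 := rpow_le_weighted_sq hp (show 0 < 1 + x by linarith)
    have i1 : ((1 - x) ^ 2)⁻¹ + ((1 + x) ^ 2)⁻¹ ≤ 2 * (1 + 8 * x ^ 2) := by
      have hy : x ^ 2 ≤ 1 / 4 := by nlinarith
      have : ((1 - x) ^ 2)⁻¹ + ((1 + x) ^ 2)⁻¹ = 2 * (1 + x ^ 2) / (1 - x ^ 2) ^ 2 := by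
        have : 1 - x ≠ 0 := by linarith
        have : 1 + x ≠ 0 := by linarith
        have : 1 - x ^ 2 ≠ 0 := by nlinarith
        field_simp
        ring
      rw [this, div_le_iff₀ (by nlinarith [sq_nonneg x])]
      nlinarith [sq_nonneg x, mul_nonneg (sq_nonneg x) (sub_nonneg.mpr hy),
        mul_nonneg (mul_nonneg (sq_nonneg x) (sq_nonneg x)) (sub_nonneg.mpr hy),
        mul_nonneg (sq_nonneg x) (sq_nonneg x)]
    have i2 : (1 - x) ^ 2 + (1 + x) ^ 2 ≤ 2 * (1 + 8 * x ^ 2) := by nlinarith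
    have j1 := mul_le_mul_of_nonneg_left i1 (show 0 ≤ (2 - p) / 4 by linarith)
    have j2 := mul_le_mul_of_nonneg_left i2 (show 0 ≤ (2 + p) / 4 by linarith)
    linarith
  simp only
  rw [e1, e2, e3, Real.mul_rpow hs0.le (by linarith), Real.mul_rpow hs0.le (by linarith)]
  nlinarith [mul_le_mul_of_nonneg_left key (Real.rpow_nonneg hs0.le p)]

theorem exists_max_of_eventually_le_one {f : ℕ → ℝ} {N₀ : ℕ} (hev : ∃ N, ∀ n ≥ N, f n ≤ 1)
    (h : ∃ n ≥ N₀, 1 < f n) : ∃ k ≥ N₀, 1 < f k ∧ ∀ n ≥ N₀, f n ≤ f k := by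
  obtain ⟨N, hN⟩ := hev
  obtain ⟨n₁, hn₁, h1⟩ := h
  have hlt : n₁ < N := by
    by_contra! hc
    linarith [hN n₁ hc]
  obtain ⟨k, hk, hmax⟩ := (Finset.Icc N₀ N).exists_max_image f ⟨n₁, by simp; omega⟩
  have hk1 : 1 < f k := h1.trans_le (hmax n₁ (by simp; omega))
  refine ⟨k, (Finset.mem_Icc.mp hk).1, hk1, fun n hn => ?_⟩
  rcases le_or_gt n N with h2 | h2
  · exact hmax n (by simp; omega)
  · linarith [hN n h2.le]

theorem rpow_third_pow {s : ℝ} (hs : 0 ≤ s) : (s ^ ((1:ℝ) / 3)) ^ 3 = s := by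
  rw [← Real.rpow_natCast, ← Real.rpow_mul hs]; norm_num

theorem rpow_neg_third {s : ℝ} (hs : 0 ≤ s) : s ^ (-(1:ℝ) / 3) = (s ^ ((1:ℝ) / 3))⁻¹ := by
  rw [← Real.rpow_neg hs]; norm_num

theorem rpow_two_thirds {s : ℝ} (hs : 0 ≤ s) : s ^ ((2:ℝ) / 3) = (s ^ ((1:ℝ) / 3)) ^ 2 := by
  rw [← Real.rpow_natCast, ← Real.rpow_mul hs]; norm_num

theorem rpow_neg_two_thirds {s : ℝ} (hs : 0 ≤ s) :
    s ^ (-(2:ℝ) / 3) = ((s ^ ((1:ℝ) / 3)) ^ 2)⁻¹ := by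
  rw [← rpow_two_thirds hs, ← Real.rpow_neg hs]; norm_num

theorem AlmostMidconcave.congr {F G : ℝ → ℝ} (hF : AlmostMidconcave F)
    (h : ∀ s, 0 < s → G s = F s) : AlmostMidconcave G := fun s hs => by
  rw [h _ (by linarith), h _ (by linarith), h s (by linarith)]
  exact hF s hs

theorem almostMidconcave_rpow_comb {p₀ p₁ p₂ : ℝ} (h₀ : |p₀| ≤ 2) (h₁ : |p₁| ≤ 2) (h₂ : |p₂| ≤ 2)
    {c₀ c₁ c₂ : ℝ} (hc₀ : 0 ≤ c₀) (hc₁ : 0 ≤ c₁) (hc₂ : 0 ≤ c₂) :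
    AlmostMidconcave (fun s => c₀ * s ^ p₀ + c₁ * s ^ p₁ + c₂ * s ^ p₂) :=
  (((AlmostMidconcave.rpow h₀).const_mul hc₀).add ((AlmostMidconcave.rpow h₁).const_mul hc₁)).add
    ((AlmostMidconcave.rpow h₂).const_mul hc₂)

/-- The slowly varying modulating factor of the barriers, as a function of `s ^ (1 / 3)`. -/
noncomputable def barrierFactor (c₀ c₁ c₂ σ : ℝ) : ℝ := c₀ + c₁ / σ + c₂ * σ ^ 3

/-- Upper barrier for `a n`. -/
noncomputable def upperA (κ c₀ c₁ c₂ s : ℝ) : ℝ :=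
  κ * (s ^ ((1:ℝ) / 3))⁻¹ * barrierFactor c₀ c₁ c₂ (s ^ ((1:ℝ) / 3))

/-- Upper barrier for `m n`. -/
noncomputable def upperM (κ c₀ c₁ c₂ s : ℝ) : ℝ :=
  (κ * (s ^ ((1:ℝ) / 3)) ^ 2 + κ ^ 2 / 2 * ((s ^ ((1:ℝ) / 3)) ^ 2)⁻¹) *
    barrierFactor c₀ c₁ c₂ (s ^ ((1:ℝ) / 3))

/-- Upper barrier for `(a n)⁻¹`. -/
noncomputable def upperInvA (κ c₀ c₁ c₂ s : ℝ) : ℝ :=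
  (κ⁻¹ * s ^ ((1:ℝ) / 3) + 1 / 2 * ((s ^ ((1:ℝ) / 3)) ^ 3)⁻¹) *
    barrierFactor c₀ c₁ c₂ (s ^ ((1:ℝ) / 3))

/-- Upper barrier for `(m n)⁻¹`. -/
noncomputable def upperInvM (κ c₀ c₁ c₂ s : ℝ) : ℝ :=
  κ⁻¹ * ((s ^ ((1:ℝ) / 3)) ^ 2)⁻¹ * barrierFactor c₀ c₁ c₂ (s ^ ((1:ℝ) / 3))

theorem barrierFactor_smul (R c₀ c₁ c₂ σ : ℝ) :
    barrierFactor (R * c₀) (R * c₁) (R * c₂) σ = R * barrierFactor c₀ c₁ c₂ σ := by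
  unfold barrierFactor; ring

theorem rpow_eq_zpow_third {s : ℝ} (hs : 0 < s) (p : ℝ) (k : ℤ) (h : p = k / 3) :
    s ^ p = (s ^ ((1:ℝ) / 3)) ^ k := by
  rw [← Real.rpow_intCast, ← Real.rpow_mul hs.le, h]
  congr 1
  ring

section

variable {κ c₀ c₁ c₂ : ℝ} (hκ : 0 < κ) (h₀ : 0 ≤ c₀) (h₁ : 0 ≤ c₁) (h₂ : 0 ≤ c₂)
include hκ h₀ h₁ h₂

theorem almostMidconcave_upperA : AlmostMidconcave (upperA κ c₀ c₁ c₂) := by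
  refine ((almostMidconcave_rpow_comb (p₀ := -1 / 3) (p₁ := -2 / 3) (p₂ := 2 / 3)
    (by norm_num [abs_le]) (by norm_num [abs_le]) (by norm_num [abs_le]) h₀ h₁ h₂).const_mul
    hκ.le).congr fun s hs => ?_
  have hσ : (0:ℝ) < s ^ ((1:ℝ) / 3) := by positivity
  rw [rpow_eq_zpow_third hs (-1 / 3) (-1) (by norm_num),
    rpow_eq_zpow_third hs (-2 / 3) (-2) (by norm_num),
    rpow_eq_zpow_third hs (2 / 3) 2 (by norm_num)]
  unfold upperA barrierFactor
  set σ := s ^ ((1:ℝ) / 3)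
  simp only [zpow_neg, zpow_ofNat]
  field_simp

theorem almostMidconcave_upperM : AlmostMidconcave (upperM κ c₀ c₁ c₂) := by
  refine (((almostMidconcave_rpow_comb (p₀ := 2 / 3) (p₁ := 1 / 3) (p₂ := 5 / 3)
    (by norm_num [abs_le]) (by norm_num [abs_le]) (by norm_num [abs_le]) h₀ h₁ h₂).const_mul
    hκ.le).add ((almostMidconcave_rpow_comb (p₀ := -2 / 3) (p₁ := -1) (p₂ := 1 / 3)
    (by norm_num [abs_le]) (by norm_num [abs_le]) (by norm_num [abs_le]) h₀ h₁ h₂).const_mul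
    (show 0 ≤ κ ^ 2 / 2 by positivity))).congr fun s hs => ?_
  have hσ : (0:ℝ) < s ^ ((1:ℝ) / 3) := by positivity
  rw [rpow_eq_zpow_third hs (-2 / 3) (-2) (by norm_num),
    rpow_eq_zpow_third hs (5 / 3) 5 (by norm_num),
    rpow_eq_zpow_third hs (-1) (-3) (by norm_num),
    rpow_eq_zpow_third hs (2 / 3) 2 (by norm_num)]
  unfold upperM barrierFactor
  set σ := s ^ ((1:ℝ) / 3)
  simp only [zpow_neg, zpow_ofNat]
  field_simp

theorem almostMidconcave_upperInvA : AlmostMidconcave (upperInvA κ c₀ c₁ c₂) := by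
  refine (((almostMidconcave_rpow_comb (p₀ := 1 / 3) (p₁ := 0) (p₂ := 4 / 3)
    (by norm_num [abs_le]) (by norm_num [abs_le]) (by norm_num [abs_le]) h₀ h₁ h₂).const_mul
    (inv_pos.mpr hκ).le).add ((almostMidconcave_rpow_comb (p₀ := -1) (p₁ := -4 / 3) (p₂ := 0)
    (by norm_num [abs_le]) (by norm_num [abs_le]) (by norm_num [abs_le]) h₀ h₁ h₂).const_mul
    (show (0:ℝ) ≤ 1 / 2 by positivity))).congr fun s hs => ?_
  have hσ : (0:ℝ) < s ^ ((1:ℝ) / 3) := by positivity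
  rw [rpow_eq_zpow_third hs (4 / 3) 4 (by norm_num),
    rpow_eq_zpow_third hs (-4 / 3) (-4) (by norm_num),
    rpow_eq_zpow_third hs (-1) (-3) (by norm_num), Real.rpow_zero]
  unfold upperInvA barrierFactor
  set σ := s ^ ((1:ℝ) / 3)
  simp only [zpow_neg, zpow_ofNat]
  field_simp

theorem almostMidconcave_upperInvM : AlmostMidconcave (upperInvM κ c₀ c₁ c₂) := by
  refine ((almostMidconcave_rpow_comb (p₀ := -2 / 3) (p₁ := -1) (p₂ := 1 / 3)
    (by norm_num [abs_le]) (by norm_num [abs_le]) (by norm_num [abs_le]) h₀ h₁ h₂).const_mul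
    (inv_pos.mpr hκ).le).congr fun s hs => ?_
  have hσ : (0:ℝ) < s ^ ((1:ℝ) / 3) := by positivity
  rw [rpow_eq_zpow_third hs (-2 / 3) (-2) (by norm_num),
    rpow_eq_zpow_third hs (-1) (-3) (by norm_num)]
  unfold upperInvM barrierFactor
  set σ := s ^ ((1:ℝ) / 3)
  simp only [zpow_neg, zpow_ofNat]
  field_simp

end

theorem upper_barrier_strict_at_a {κ σ φ : ℝ} (hκ : 0 < κ) (h1 : 1 ≤ σ) (h2 : κ ≤ σ)
    (h3 : 8 < κ * σ) (hφ : 1 + 1 / σ ≤ φ) :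
    2 * (1 + 2 / (σ ^ 3) ^ 2) * ((κ * σ ^ 2 + κ ^ 2 / 2 * (σ ^ 2)⁻¹) * φ)
      < 2 * σ ^ 3 * (κ * σ⁻¹ * φ) + (κ * σ⁻¹ * φ) ^ 2 := by
  have hσ : 0 < σ := by linarith
  have hφ0 : 0 < φ := lt_of_lt_of_le (by positivity) hφ
  obtain ⟨d, hd, rfl⟩ : ∃ d, 1 ≤ d ∧ φ = 1 + d / σ := by
    refine ⟨(φ - 1) * σ, ?_, by field_simp; ring⟩
    have : 1 / σ ≤ φ - 1 := by linarith
    rwa [div_le_iff₀ hσ] at this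
  have e : 2 * σ ^ 3 * (κ * σ⁻¹ * (1 + d / σ)) + (κ * σ⁻¹ * (1 + d / σ)) ^ 2
      - 2 * (1 + 2 / (σ ^ 3) ^ 2) * ((κ * σ ^ 2 + κ ^ 2 / 2 * (σ ^ 2)⁻¹) * (1 + d / σ))
      = κ * (1 + d / σ) / σ ^ 8 * (κ * d * σ ^ 5 - 4 * σ ^ 4 - 2 * κ) := by
    field_simp; ring
  have p4 : 1 ≤ σ ^ 4 := one_le_pow₀ h1
  have : 0 < κ * d * σ ^ 5 - 4 * σ ^ 4 - 2 * κ := by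
    have k1 : 8 * σ ^ 4 < κ * σ * σ ^ 4 := by nlinarith
    have k2 : κ * σ ^ 5 ≤ κ * d * σ ^ 5 := by
      have : 0 < κ * σ ^ 5 := by positivity
      nlinarith
    have k3 : σ ≤ σ ^ 4 := le_self_pow₀ h1 (by norm_num)
    nlinarith
  have : 0 < κ * (1 + d / σ) / σ ^ 8 * (κ * d * σ ^ 5 - 4 * σ ^ 4 - 2 * κ) := by positivity
  linarith

theorem upper_barrier_strict_at_m {κ σ φ : ℝ} (hκ : 0 < κ) (h1 : 1 ≤ σ)
    (h3 : 8 < κ * σ) (hφ : 1 + 1 / σ ≤ φ) :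
    σ ^ 3 * ((κ * σ ^ 2 + κ ^ 2 / 2 * (σ ^ 2)⁻¹) * φ) * (κ * σ⁻¹ * φ) * (1 + 2 / (σ ^ 3) ^ 2)
      < ((κ * σ ^ 2 + κ ^ 2 / 2 * (σ ^ 2)⁻¹) * φ) ^ 2 - κ ^ 3 / 2 := by
  have hσ : 0 < σ := by linarith
  have hφ0 : 0 < φ := lt_of_lt_of_le (by positivity) hφ
  have e : ((κ * σ ^ 2 + κ ^ 2 / 2 * (σ ^ 2)⁻¹) * φ) ^ 2 - κ ^ 3 / 2 -
      σ ^ 3 * ((κ * σ ^ 2 + κ ^ 2 / 2 * (σ ^ 2)⁻¹) * φ) * (κ * σ⁻¹ * φ) * (1 + 2 / (σ ^ 3) ^ 2)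
      = κ ^ 2 / 2 * (κ * φ ^ 2 * (1 - 4 / (κ * σ ^ 2)) - κ) +
        κ ^ 3 / (4 * σ ^ 6) * φ ^ 2 * (κ * σ ^ 2 - 4) := by
    field_simp; ring
  have g1 : 0 ≤ κ * σ ^ 2 - 4 := by nlinarith
  have g2 : 0 < κ * φ ^ 2 * (1 - 4 / (κ * σ ^ 2)) - κ := by
    have hφ2 : 1 + 2 / σ ≤ φ ^ 2 := by
      have : (1 + 1 / σ) ^ 2 ≤ φ ^ 2 := pow_le_pow_left₀ (by positivity) hφ 2
      have e : (1 + 1 / σ) ^ 2 = 1 + 2 / σ + 1 / σ ^ 2 := by field_simp; ring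
      have : 0 < 1 / σ ^ 2 := by positivity
      linarith
    have hx : 0 ≤ 1 - 4 / (κ * σ ^ 2) := by
      rw [sub_nonneg, div_le_one (by positivity)]; linarith
    have h4 : 1 < (1 + 2 / σ) * (1 - 4 / (κ * σ ^ 2)) := by
      have : (1 + 2 / σ) * (1 - 4 / (κ * σ ^ 2)) - 1 =
        2 / (κ * σ ^ 3) * (κ * σ ^ 2 - 2 * σ - 4) := by field_simp; ring
      have : 0 < 2 / (κ * σ ^ 3) * (κ * σ ^ 2 - 2 * σ - 4) := by
        have : 0 < κ * σ ^ 2 - 2 * σ - 4 := by nlinarith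
        positivity
      linarith
    have h5 := mul_le_mul_of_nonneg_right hφ2 hx
    nlinarith
  have : 0 < κ ^ 2 / 2 * (κ * φ ^ 2 * (1 - 4 / (κ * σ ^ 2)) - κ) +
        κ ^ 3 / (4 * σ ^ 6) * φ ^ 2 * (κ * σ ^ 2 - 4) := by positivity
  linarith

theorem lower_barrier_strict_at_a {κ σ φ : ℝ} (hκ : 0 < κ) (h1 : 1 ≤ σ)
    (h3 : 16 < κ * σ) (h2 : κ ≤ σ) (hφ : 1 + 1 / σ ≤ φ) :
    (2 * σ ^ 3 * ((κ⁻¹ * σ + 1 / 2 * (σ ^ 3)⁻¹) * φ)⁻¹ +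
      (((κ⁻¹ * σ + 1 / 2 * (σ ^ 3)⁻¹) * φ)⁻¹) ^ 2) *
      ((1 + 2 / (σ ^ 3) ^ 2) * (κ⁻¹ * (σ ^ 2)⁻¹ * φ)) < 2 := by
  have hσ : 0 < σ := by linarith
  obtain ⟨d, hd, rfl⟩ : ∃ d, 1 ≤ d ∧ φ = 1 + d / σ := by
    refine ⟨(φ - 1) * σ, ?_, by field_simp; ring⟩
    have : 1 / σ ≤ φ - 1 := by linarith
    rwa [div_le_iff₀ hσ] at this
  have hd0 : 0 < d := by linarith
  have e : (2 * σ ^ 3 * ((κ⁻¹ * σ + 1 / 2 * (σ ^ 3)⁻¹) * (1 + d / σ))⁻¹ +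
      (((κ⁻¹ * σ + 1 / 2 * (σ ^ 3)⁻¹) * (1 + d / σ))⁻¹) ^ 2) *
      ((1 + 2 / (σ ^ 3) ^ 2) * (κ⁻¹ * (σ ^ 2)⁻¹ * (1 + d / σ))) =
      2 * ((2 * σ ^ 4 * (2 * σ ^ 4 + κ) * (σ + d) + 2 * κ * σ ^ 5) * (σ ^ 6 + 2)) /
        ((2 * σ ^ 4 + κ) ^ 2 * (σ + d) * σ ^ 6) := by
    field_simp
  rw [e, div_lt_iff₀ (by positivity)]
  have p : 0 < 2 * κ * d * σ ^ 10 + κ ^ 2 * σ ^ 6 * (σ + d) - 8 * σ ^ 9 - 8 * σ ^ 8 * d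
      - 8 * κ * σ ^ 5 - 4 * κ * σ ^ 4 * d := by
    have k1 : 16 * (d * σ ^ 9) ≤ κ * σ * (d * σ ^ 9) := 
      mul_le_mul_of_nonneg_right h3.le (by positivity)
    have k2 : d * σ ^ 8 ≤ d * σ ^ 9 := by
      apply mul_le_mul_of_nonneg_left (pow_le_pow_right₀ h1 (by norm_num)) hd0.le
    have k3 : σ ^ 9 ≤ d * σ ^ 9 := by nlinarith [pow_pos hσ 9]
    have k4 : κ * σ ^ 5 ≤ d * σ ^ 9 := by
      calc κ * σ ^ 5 ≤ σ * σ ^ 5 := by gcongr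
        _ = 1 * σ ^ 6 := by ring
        _ ≤ d * σ ^ 9 := mul_le_mul hd (pow_le_pow_right₀ h1 (by norm_num)) (by positivity) hd0.le
    have k5 : κ * (d * σ ^ 4) ≤ d * σ ^ 9 := by
      calc κ * (d * σ ^ 4) ≤ σ * (d * σ ^ 4) := by gcongr
        _ = d * σ ^ 5 := by ring
        _ ≤ d * σ ^ 9 := by gcongr; norm_num
    have k6 : 0 < κ ^ 2 * σ ^ 6 * (σ + d) := by positivity
    have k7 : 0 < d * σ ^ 9 := by positivity
    nlinarith
  nlinarith

theorem lower_barrier_strict_at_m {κ G σ φ : ℝ} (hκ : 0 < κ) (h1 : 1 ≤ σ) (hG : 0 ≤ G)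
    (h3 : 8 < κ * σ) (h2 : κ ≤ σ) (hφ : 1 + (G + 1) / σ ≤ φ) :
    (1 + 2 / (σ ^ 3) ^ 2) * ((κ⁻¹ * σ + 1 / 2 * (σ ^ 3)⁻¹) * φ) *
      (((κ⁻¹ * (σ ^ 2)⁻¹ * φ)⁻¹) ^ 2 - κ ^ 3 / 2)
      < σ ^ 3 * (κ⁻¹ * (σ ^ 2)⁻¹ * φ)⁻¹ - G * κ ^ 2 / 2 := by
  have hσ : 0 < σ := by linarith
  have hφ0 : 0 < φ := lt_of_lt_of_le (by positivity) hφ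
  have hE : (1 + 2 / (σ ^ 3) ^ 2) * (1 + κ / (2 * σ ^ 4)) - 1 ≤
      κ / (2 * σ ^ 4) * (1 + 8 / (κ * σ ^ 2)) := by
    have : κ / (2 * σ ^ 4) * (1 + 8 / (κ * σ ^ 2)) -
      ((1 + 2 / (σ ^ 3) ^ 2) * (1 + κ / (2 * σ ^ 4)) - 1) = (2 * σ ^ 4 - κ) / σ ^ 10 := by
      field_simp; ring
    have : 0 ≤ (2 * σ ^ 4 - κ) / σ ^ 10 := by
      apply div_nonneg _ (by positivity)
      have : σ ≤ σ ^ 4 := le_self_pow₀ h1 (by norm_num)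
      linarith
    linarith
  set E := (1 + 2 / (σ ^ 3) ^ 2) * (1 + κ / (2 * σ ^ 4)) - 1 with hEdef
  have hE0 : 0 ≤ E := by
    have : E = 2 / (σ ^ 3) ^ 2 + κ / (2 * σ ^ 4) + 2 / (σ ^ 3) ^ 2 * (κ / (2 * σ ^ 4)) := by
      rw [hEdef]; ring
    rw [this]; positivity
  have hMinv : (κ⁻¹ * (σ ^ 2)⁻¹ * φ)⁻¹ = κ * σ ^ 2 / φ := by field_simp
  rw [hMinv]
  have e1 : (1 + 2 / (σ ^ 3) ^ 2) * ((κ⁻¹ * σ + 1 / 2 * (σ ^ 3)⁻¹) * φ) =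
      (1 + E) * (σ * φ / κ) := by
    rw [hEdef]; field_simp; ring
  rw [e1]
  have e2 : σ ^ 3 * (κ * σ ^ 2 / φ) - G * κ ^ 2 / 2 - (1 + E) * (σ * φ / κ) *
      ((κ * σ ^ 2 / φ) ^ 2 - κ ^ 3 / 2) =
      (σ * κ ^ 2 / (2 * φ)) * ((1 + E) * φ ^ 2 - G * φ / σ - 2 * E * σ ^ 4 / κ) := by
    field_simp; ring
  have key : 0 < (1 + E) * φ ^ 2 - G * φ / σ - 2 * E * σ ^ 4 / κ := by
    have j1 : 2 * E * σ ^ 4 / κ ≤ 1 + 8 / (κ * σ ^ 2) := by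
      calc 2 * E * σ ^ 4 / κ ≤ 2 * (κ / (2 * σ ^ 4) * (1 + 8 / (κ * σ ^ 2))) * σ ^ 4 / κ := by
            gcongr
        _ = _ := by field_simp
    have j2 : 8 / (κ * σ ^ 2) < 1 / σ := by
      rw [div_lt_div_iff₀ (by positivity) hσ]; nlinarith
    have j3 : G * φ / σ = G / σ * φ := by ring
    have hx : (G + 1) / σ = G / σ + 1 / σ := by ring
    have hx1 : 0 < 1 / σ := by positivity
    have hx2 : 0 ≤ G / σ := by positivity
    have j4 : 0 ≤ E * φ ^ 2 := by positivity
    rw [j3]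
    nlinarith
  have : 0 < (σ * κ ^ 2 / (2 * φ)) * ((1 + E) * φ ^ 2 - G * φ / σ - 2 * E * σ ^ 4 / κ) := by
    positivity
  linarith

/-- Positive solutions of the second order difference system satisfied by the shifted auxiliary
quantities of the perturbed Laguerre ladder operators. -/
structure IsPositiveSolution (α t : ℝ) (a m : ℕ → ℝ) : Prop where
  a_pos : ∀ n, 0 < a n
  m_gt : ∀ n ≥ 1, t / 2 < m n
  sum_m : ∀ n : ℕ, 1 ≤ n → m n + m (n + 1) = 2 * ((n:ℝ) + α / 2 + 1 / 2) * a n + a n ^ 2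
  sum_inv_a : ∀ n : ℕ, ((a (n + 1))⁻¹ + (a n)⁻¹) * (m (n + 1) ^ 2 - t ^ 2 / 4) =
    2 * ((n:ℝ) + 1 + α / 2) * m (n + 1) - α * t / 2

/-- Quantification of "`s` is large" for the barrier estimates. -/
def LargeFor (κ s : ℝ) : Prop :=
  1 ≤ s ^ ((1:ℝ) / 3) ∧ κ ≤ s ^ ((1:ℝ) / 3) ∧ 16 < κ * s ^ ((1:ℝ) / 3)

theorem LargeFor.mono {κ s s' : ℝ} (hκ : 0 < κ) (hs : 0 ≤ s) (h : LargeFor κ s) (hss : s ≤ s') :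
    LargeFor κ s' := by
  have : s ^ ((1:ℝ) / 3) ≤ s' ^ ((1:ℝ) / 3) := Real.rpow_le_rpow hs hss (by norm_num)
  obtain ⟨h1, h2, h3⟩ := h
  exact ⟨h1.trans this, h2.trans this, h3.trans_le (by gcongr)⟩

theorem le_barrierFactor {c₀ c₁ c₂ σ : ℝ} (h₀ : 1 ≤ c₀) (h₂ : 0 ≤ c₂) (hσ : 0 < σ) :
    1 + c₁ / σ ≤ barrierFactor c₀ c₁ c₂ σ := by
  unfold barrierFactor
  have : 0 ≤ c₂ * σ ^ 3 := by positivity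
  linarith

theorem upperA_strict {κ c₀ c₁ c₂ s : ℝ} (hκ : 0 < κ) (h₀ : 1 ≤ c₀) (h₁ : 1 ≤ c₁) (h₂ : 0 ≤ c₂)
    (hs : 1 ≤ s) (hL : LargeFor κ s) :
    upperM κ c₀ c₁ c₂ (s - 1 / 2) + upperM κ c₀ c₁ c₂ (s + 1 / 2) <
      2 * s * upperA κ c₀ c₁ c₂ s + upperA κ c₀ c₁ c₂ s ^ 2 := by
  refine (almostMidconcave_upperM hκ (by linarith) (by linarith) h₂ s hs).trans_lt ?_
  obtain ⟨h1, h2, h3⟩ := hL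
  unfold upperM upperA
  have hσ3 := rpow_third_pow (s := s) (by linarith)
  set σ := s ^ ((1:ℝ) / 3)
  rw [← hσ3]
  have hσ : 0 < σ := by linarith
  refine upper_barrier_strict_at_a hκ h1 h2 (by linarith) ?_
  refine le_trans ?_ (le_barrierFactor h₀ h₂ hσ)
  gcongr

theorem upperM_strict {κ c₀ c₁ c₂ s : ℝ} (hκ : 0 < κ) (h₀ : 1 ≤ c₀) (h₁ : 1 ≤ c₁) (h₂ : 0 ≤ c₂)
    (hs : 1 ≤ s) (hL : LargeFor κ s) :
    s * upperM κ c₀ c₁ c₂ s * (upperA κ c₀ c₁ c₂ (s - 1 / 2) + upperA κ c₀ c₁ c₂ (s + 1 / 2)) <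
      2 * (upperM κ c₀ c₁ c₂ s ^ 2 - κ ^ 3 / 2) := by
  have hmid := almostMidconcave_upperA hκ (by linarith) (by linarith) h₂ s hs (c₀ := c₀) (c₁ := c₁)
  obtain ⟨h1, h2, h3⟩ := hL
  have hσ : 0 < s ^ ((1:ℝ) / 3) := by linarith
  have hφ := le_barrierFactor (c₁ := c₁) h₀ h₂ hσ
  have hM : 0 ≤ s * upperM κ c₀ c₁ c₂ s := by
    unfold upperM
    have : 0 < barrierFactor c₀ c₁ c₂ (s ^ ((1:ℝ) / 3)) := lt_of_lt_of_le (by positivity) hφ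
    positivity
  refine (mul_le_mul_of_nonneg_left hmid hM).trans_lt ?_
  unfold upperM upperA
  have hσ3 := rpow_third_pow (s := s) (by linarith)
  set σ := s ^ ((1:ℝ) / 3)
  rw [← hσ3]
  have := upper_barrier_strict_at_m (φ := barrierFactor c₀ c₁ c₂ σ) hκ h1 (by linarith)
    (le_trans (by gcongr) hφ)
  linarith

theorem upperInvA_strict {κ c₀ c₁ c₂ s : ℝ} (hκ : 0 < κ) (h₀ : 1 ≤ c₀) (h₁ : 1 ≤ c₁) (h₂ : 0 ≤ c₂)
    (hs : 1 ≤ s) (hL : LargeFor κ s) :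
    (2 * s * (upperInvA κ c₀ c₁ c₂ s)⁻¹ + ((upperInvA κ c₀ c₁ c₂ s)⁻¹) ^ 2) *
      (upperInvM κ c₀ c₁ c₂ (s - 1 / 2) + upperInvM κ c₀ c₁ c₂ (s + 1 / 2)) < 4 := by
  have hmid := almostMidconcave_upperInvM hκ (by linarith) (by linarith) h₂ s hs
    (c₀ := c₀) (c₁ := c₁)
  obtain ⟨h1, h2, h3⟩ := hL
  have hσ : 0 < s ^ ((1:ℝ) / 3) := by linarith
  have hφ := le_barrierFactor (c₁ := c₁) h₀ h₂ hσ
  have hA : 0 ≤ 2 * s * (upperInvA κ c₀ c₁ c₂ s)⁻¹ + ((upperInvA κ c₀ c₁ c₂ s)⁻¹) ^ 2 := by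
    unfold upperInvA
    have : 0 < barrierFactor c₀ c₁ c₂ (s ^ ((1:ℝ) / 3)) := lt_of_lt_of_le (by positivity) hφ
    positivity
  refine (mul_le_mul_of_nonneg_left hmid hA).trans_lt ?_
  unfold upperInvM upperInvA
  have hσ3 := rpow_third_pow (s := s) (by linarith)
  set σ := s ^ ((1:ℝ) / 3)
  rw [← hσ3]
  have := lower_barrier_strict_at_a (φ := barrierFactor c₀ c₁ c₂ σ) hκ h1 h3 h2
    (le_trans (by gcongr) hφ)
  linarith

theorem upperInvM_strict {κ G c₀ c₁ c₂ s : ℝ} (hκ : 0 < κ) (hG : 0 ≤ G) (h₀ : 1 ≤ c₀)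
    (h₁ : G + 1 ≤ c₁) (h₂ : 0 ≤ c₂) (hs : 1 ≤ s) (hL : LargeFor κ s)
    (hM : κ ^ 3 / 2 < ((upperInvM κ c₀ c₁ c₂ s)⁻¹) ^ 2) :
    (upperInvA κ c₀ c₁ c₂ (s - 1 / 2) + upperInvA κ c₀ c₁ c₂ (s + 1 / 2)) *
      (((upperInvM κ c₀ c₁ c₂ s)⁻¹) ^ 2 - κ ^ 3 / 2) <
      2 * s * (upperInvM κ c₀ c₁ c₂ s)⁻¹ - G * κ ^ 2 := by
  have hmid := almostMidconcave_upperInvA hκ (by linarith) (by linarith) h₂ s hs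
    (c₀ := c₀) (c₁ := c₁)
  obtain ⟨h1, h2, h3⟩ := hL
  have hσ : 0 < s ^ ((1:ℝ) / 3) := by linarith
  have hφ := le_barrierFactor (c₁ := c₁) h₀ h₂ hσ
  refine (mul_le_mul_of_nonneg_right hmid (sub_pos.mpr hM).le).trans_lt ?_
  unfold upperInvM upperInvA
  have hσ3 := rpow_third_pow (s := s) (by linarith)
  set σ := s ^ ((1:ℝ) / 3)
  rw [← hσ3]
  have := lower_barrier_strict_at_m (φ := barrierFactor c₀ c₁ c₂ σ) hκ h1 hG (by linarith) h2
    (le_trans (by gcongr) hφ)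
  linarith

section

variable {κ c₀ c₁ c₂ s : ℝ} (hκ : 0 < κ) (h₀ : 0 < c₀) (h₁ : 0 ≤ c₁) (h₂ : 0 ≤ c₂) (hs : 0 < s)
include h₀ h₁ h₂ hs

theorem barrierFactor_pos : 0 < barrierFactor c₀ c₁ c₂ (s ^ ((1:ℝ) / 3)) := by
  unfold barrierFactor; positivity

include hκ

theorem upperA_pos : 0 < upperA κ c₀ c₁ c₂ s := by
  have := barrierFactor_pos h₀ h₁ h₂ hs
  unfold upperA; positivity

theorem upperM_pos : 0 < upperM κ c₀ c₁ c₂ s := by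
  have := barrierFactor_pos h₀ h₁ h₂ hs
  unfold upperM; positivity

theorem upperInvA_pos : 0 < upperInvA κ c₀ c₁ c₂ s := by
  have := barrierFactor_pos h₀ h₁ h₂ hs
  unfold upperInvA; positivity

theorem upperInvM_pos : 0 < upperInvM κ c₀ c₁ c₂ s := by
  have := barrierFactor_pos h₀ h₁ h₂ hs
  unfold upperInvM; positivity

end

theorem four_div_add_le {x y : ℝ} (hx : 0 < x) (hy : 0 < y) : 4 / (x + y) ≤ x⁻¹ + y⁻¹ := by
  rw [inv_add_inv hx.ne' hy.ne', div_le_div_iff₀ (by positivity) (by positivity)]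
  nlinarith [sq_nonneg (x - y)]

section

variable {α t κ c₁ c₂ : ℝ} {a m : ℕ → ℝ} {N₀ : ℕ}

theorem IsPositiveSolution.le_upper (hS : IsPositiveSolution α t a m) (hα : 0 < α) (ht : 0 < t)
    (hκ : 0 < κ) (hκ3 : κ ^ 3 = t ^ 2 / 2) (hN₀ : 1 ≤ N₀) (hL : LargeFor κ ((N₀:ℝ) + α / 2))
    (h₁ : 1 ≤ c₁) (h₂ : 0 ≤ c₂) (hstart : m N₀ ≤ upperM κ 1 c₁ c₂ ((N₀:ℝ) + α / 2))
    (hev : ∃ N, ∀ n ≥ N, a n ≤ upperA κ 1 c₁ c₂ ((n:ℝ) + α / 2 + 1 / 2) ∧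
      m n ≤ upperM κ 1 c₁ c₂ ((n:ℝ) + α / 2)) :
    ∀ n ≥ N₀, a n ≤ upperA κ 1 c₁ c₂ ((n:ℝ) + α / 2 + 1 / 2) ∧
      m n ≤ upperM κ 1 c₁ c₂ ((n:ℝ) + α / 2) := by
  have hApos : ∀ n : ℕ, 0 < upperA κ 1 c₁ c₂ ((n:ℝ) + α / 2 + 1 / 2) := fun n =>
    upperA_pos hκ one_pos (by linarith) h₂ (by positivity)
  have hMpos : ∀ n : ℕ, 0 < upperM κ 1 c₁ c₂ ((n:ℝ) + α / 2) := fun n =>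
    upperM_pos hκ one_pos (by linarith) h₂ (by positivity)
  set f : ℕ → ℝ := fun n => max (a n / upperA κ 1 c₁ c₂ ((n:ℝ) + α / 2 + 1 / 2))
    (m n / upperM κ 1 c₁ c₂ ((n:ℝ) + α / 2)) with hf
  have hiff : ∀ n R, f n ≤ R ↔ a n ≤ R * upperA κ 1 c₁ c₂ ((n:ℝ) + α / 2 + 1 / 2) ∧
      m n ≤ R * upperM κ 1 c₁ c₂ ((n:ℝ) + α / 2) := fun n R => by
    rw [hf, max_le_iff, div_le_iff₀ (hApos n), div_le_iff₀ (hMpos n)]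
  by_contra! hcon
  obtain ⟨n₁, hn₁, hn₁'⟩ := hcon
  obtain ⟨k, hk, hk1, hmax⟩ := exists_max_of_eventually_le_one (f := f) (N₀ := N₀)
    (by
      obtain ⟨N, hN⟩ := hev
      exact ⟨N, fun n hn => (hiff n 1).mpr (by simpa using hN n hn)⟩)
    ⟨n₁, hn₁, by
      by_contra! hle
      have := (hiff n₁ 1).mp hle
      rw [one_mul, one_mul] at this
      linarith [hn₁' this.1]⟩
  set R := f k with hR
  have hA : ∀ n ≥ N₀, a n ≤ upperA κ R (R * c₁) (R * c₂) ((n:ℝ) + α / 2 + 1 / 2) := fun n hn => by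
    refine ((hiff n R).mp (hmax n hn)).1.trans_eq ?_
    have := barrierFactor_smul R 1 c₁ c₂ (((n:ℝ) + α / 2 + 1 / 2) ^ ((1:ℝ) / 3))
    unfold upperA
    rw [mul_one] at this
    rw [this]; ring
  have hM : ∀ n ≥ N₀, m n ≤ upperM κ R (R * c₁) (R * c₂) ((n:ℝ) + α / 2) := fun n hn => by
    refine ((hiff n R).mp (hmax n hn)).2.trans_eq ?_
    have := barrierFactor_smul R 1 c₁ c₂ (((n:ℝ) + α / 2) ^ ((1:ℝ) / 3))
    unfold upperM
    rw [mul_one] at this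
    rw [this]; ring
  have hRc₁ : 1 ≤ R * c₁ := by nlinarith
  have hRc₂ : 0 ≤ R * c₂ := by positivity
  have hkN : (N₀:ℝ) ≤ k := by exact_mod_cast hk
  have hk1' : (1:ℝ) ≤ k := by exact_mod_cast hN₀.trans hk
  have hN0 : (0:ℝ) ≤ (N₀:ℝ) + α / 2 := by positivity
  rcases max_choice (a k / upperA κ 1 c₁ c₂ ((k:ℝ) + α / 2 + 1 / 2))
    (m k / upperM κ 1 c₁ c₂ ((k:ℝ) + α / 2)) with hc | hc
  · have heq : a k = upperA κ R (R * c₁) (R * c₂) ((k:ℝ) + α / 2 + 1 / 2) := by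
      have h1 : R = a k / upperA κ 1 c₁ c₂ ((k:ℝ) + α / 2 + 1 / 2) := hc
      rw [eq_div_iff (hApos k).ne'] at h1
      rw [← h1]
      have := barrierFactor_smul R 1 c₁ c₂ (((k:ℝ) + α / 2 + 1 / 2) ^ ((1:ℝ) / 3))
      unfold upperA
      rw [mul_one] at this
      rw [this]; ring
    have hst := upperA_strict (s := (k:ℝ) + α / 2 + 1 / 2) hκ hk1.le hRc₁ hRc₂ (by linarith)
      (hL.mono hκ hN0 (by linarith))
    have e1 := hS.sum_m k (hN₀.trans hk)
    have e2 := hM k hk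
    have e3 := hM (k + 1) (by omega)
    rw [← heq, show (k:ℝ) + α / 2 + 1 / 2 - 1 / 2 = (k:ℝ) + α / 2 by ring,
      show (k:ℝ) + α / 2 + 1 / 2 + 1 / 2 = ((k + 1 : ℕ):ℝ) + α / 2 by push_cast; ring] at hst
    linarith
  · have heq : m k = upperM κ R (R * c₁) (R * c₂) ((k:ℝ) + α / 2) := by
      have h1 : R = m k / upperM κ 1 c₁ c₂ ((k:ℝ) + α / 2) := hc
      rw [eq_div_iff (hMpos k).ne'] at h1
      rw [← h1]
      have := barrierFactor_smul R 1 c₁ c₂ (((k:ℝ) + α / 2) ^ ((1:ℝ) / 3))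
      unfold upperM
      rw [mul_one] at this
      rw [this]; ring
    have hkne : k ≠ N₀ := by
      rintro rfl
      have h1 : R = m k / upperM κ 1 c₁ c₂ ((k:ℝ) + α / 2) := hc
      rw [h1, one_lt_div (hMpos k)] at hk1
      linarith
    obtain ⟨j, rfl⟩ : ∃ j, k = j + 1 := ⟨k - 1, by omega⟩
    have hst := upperM_strict (s := ((j + 1 : ℕ):ℝ) + α / 2) hκ hk1.le hRc₁ hRc₂ (by linarith)
      (hL.mono hκ hN0 (by linarith))
    have e1 := hS.sum_inv_a j
    have e2 := hA j (by omega)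
    have e3 := hA (j + 1) (by omega)
    rw [← heq, show ((j + 1 : ℕ):ℝ) + α / 2 - 1 / 2 = (j:ℝ) + α / 2 + 1 / 2 by push_cast; ring]
      at hst
    have hmg := hS.m_gt (j + 1) (by omega)
    have hm0 : 0 < m (j + 1) := by linarith
    have hm2 : 0 < m (j + 1) ^ 2 - t ^ 2 / 4 := by nlinarith
    have ha0 := hS.a_pos j
    have ha1 := hS.a_pos (j + 1)
    have h4 := mul_le_mul_of_nonneg_right (four_div_add_le ha1 ha0) hm2.le
    rw [e1, div_mul_eq_mul_div, div_le_iff₀ (by positivity)] at h4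
    have h5 : ((j + 1 : ℕ):ℝ) = (j:ℝ) + 1 := by push_cast; ring
    rw [h5] at hst e3
    have h6 : 0 < α * t / 2 * (a (j + 1) + a j) := by positivity
    have h7 : ((j:ℝ) + 1 + α / 2) * m (j + 1) * (a j + a (j + 1)) ≤
        ((j:ℝ) + 1 + α / 2) * m (j + 1) * (upperA κ R (R * c₁) (R * c₂) ((j:ℝ) + α / 2 + 1 / 2) +
          upperA κ R (R * c₁) (R * c₂) ((j:ℝ) + 1 + α / 2 + 1 / 2)) :=
      mul_le_mul_of_nonneg_left (add_le_add e2 e3) (by positivity)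
    nlinarith

theorem IsPositiveSolution.inv_le_upper (hS : IsPositiveSolution α t a m) (hα : 0 < α)
    (ht : 0 < t) (hκ : 0 < κ) (hκ3 : κ ^ 3 = t ^ 2 / 2) (hN₀ : 1 ≤ N₀)
    (hL : LargeFor κ ((N₀:ℝ) + α / 2)) (h₁ : α * t / (2 * κ ^ 2) + 1 ≤ c₁) (h₂ : 0 ≤ c₂)
    (hstart : (m N₀)⁻¹ ≤ upperInvM κ 1 c₁ c₂ ((N₀:ℝ) + α / 2))
    (hev : ∃ N, ∀ n ≥ N, (a n)⁻¹ ≤ upperInvA κ 1 c₁ c₂ ((n:ℝ) + α / 2 + 1 / 2) ∧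
      (m n)⁻¹ ≤ upperInvM κ 1 c₁ c₂ ((n:ℝ) + α / 2)) :
    ∀ n ≥ N₀, (a n)⁻¹ ≤ upperInvA κ 1 c₁ c₂ ((n:ℝ) + α / 2 + 1 / 2) ∧
      (m n)⁻¹ ≤ upperInvM κ 1 c₁ c₂ ((n:ℝ) + α / 2) := by
  have hG : 0 ≤ α * t / (2 * κ ^ 2) := by positivity
  have hc₁ : 1 ≤ c₁ := by linarith
  have hApos : ∀ n : ℕ, 0 < upperInvA κ 1 c₁ c₂ ((n:ℝ) + α / 2 + 1 / 2) := fun n =>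
    upperInvA_pos hκ one_pos (by linarith) h₂ (by positivity)
  have hMpos : ∀ n : ℕ, 0 < upperInvM κ 1 c₁ c₂ ((n:ℝ) + α / 2) := fun n =>
    upperInvM_pos hκ one_pos (by linarith) h₂ (by positivity)
  set f : ℕ → ℝ := fun n => max ((a n)⁻¹ / upperInvA κ 1 c₁ c₂ ((n:ℝ) + α / 2 + 1 / 2))
    ((m n)⁻¹ / upperInvM κ 1 c₁ c₂ ((n:ℝ) + α / 2)) with hf
  have hiff : ∀ n R, f n ≤ R ↔ (a n)⁻¹ ≤ R * upperInvA κ 1 c₁ c₂ ((n:ℝ) + α / 2 + 1 / 2) ∧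
      (m n)⁻¹ ≤ R * upperInvM κ 1 c₁ c₂ ((n:ℝ) + α / 2) := fun n R => by
    rw [hf, max_le_iff, div_le_iff₀ (hApos n), div_le_iff₀ (hMpos n)]
  by_contra! hcon
  obtain ⟨n₁, hn₁, hn₁'⟩ := hcon
  obtain ⟨k, hk, hk1, hmax⟩ := exists_max_of_eventually_le_one (f := f) (N₀ := N₀)
    (by
      obtain ⟨N, hN⟩ := hev
      exact ⟨N, fun n hn => (hiff n 1).mpr (by simpa using hN n hn)⟩)
    ⟨n₁, hn₁, by
      by_contra! hle
      have := (hiff n₁ 1).mp hle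
      rw [one_mul, one_mul] at this
      linarith [hn₁' this.1]⟩
  set R := f k with hR
  have hAs : ∀ n : ℕ, R * upperInvA κ 1 c₁ c₂ ((n:ℝ) + α / 2 + 1 / 2) =
      upperInvA κ R (R * c₁) (R * c₂) ((n:ℝ) + α / 2 + 1 / 2) := fun n => by
    have := barrierFactor_smul R 1 c₁ c₂ (((n:ℝ) + α / 2 + 1 / 2) ^ ((1:ℝ) / 3))
    unfold upperInvA
    rw [mul_one] at this
    rw [this]; ring
  have hMs : ∀ n : ℕ, R * upperInvM κ 1 c₁ c₂ ((n:ℝ) + α / 2) =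
      upperInvM κ R (R * c₁) (R * c₂) ((n:ℝ) + α / 2) := fun n => by
    have := barrierFactor_smul R 1 c₁ c₂ (((n:ℝ) + α / 2) ^ ((1:ℝ) / 3))
    unfold upperInvM
    rw [mul_one] at this
    rw [this]; ring
  have hA : ∀ n ≥ N₀, (a n)⁻¹ ≤ upperInvA κ R (R * c₁) (R * c₂) ((n:ℝ) + α / 2 + 1 / 2) :=
    fun n hn => ((hiff n R).mp (hmax n hn)).1.trans_eq (hAs n)
  have hM : ∀ n ≥ N₀, (m n)⁻¹ ≤ upperInvM κ R (R * c₁) (R * c₂) ((n:ℝ) + α / 2) :=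
    fun n hn => ((hiff n R).mp (hmax n hn)).2.trans_eq (hMs n)
  have hRc₁ : α * t / (2 * κ ^ 2) + 1 ≤ R * c₁ := by nlinarith
  have hRc₂ : 0 ≤ R * c₂ := by positivity
  have hkN : (N₀:ℝ) ≤ k := by exact_mod_cast hk
  have hk1' : (1:ℝ) ≤ k := by exact_mod_cast hN₀.trans hk
  have hN0 : (0:ℝ) ≤ (N₀:ℝ) + α / 2 := by positivity
  have hmp : ∀ n ≥ 1, 0 < m n := fun n hn => by linarith [hS.m_gt n hn]
  rcases max_choice ((a k)⁻¹ / upperInvA κ 1 c₁ c₂ ((k:ℝ) + α / 2 + 1 / 2))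
    ((m k)⁻¹ / upperInvM κ 1 c₁ c₂ ((k:ℝ) + α / 2)) with hc | hc
  · have heq : (a k)⁻¹ = upperInvA κ R (R * c₁) (R * c₂) ((k:ℝ) + α / 2 + 1 / 2) := by
      have h1 : R = (a k)⁻¹ / upperInvA κ 1 c₁ c₂ ((k:ℝ) + α / 2 + 1 / 2) := hc
      rw [eq_div_iff (hApos k).ne', hAs] at h1
      exact h1.symm
    have hst := upperInvA_strict (s := (k:ℝ) + α / 2 + 1 / 2) hκ hk1.le
      (show 1 ≤ R * c₁ by linarith) hRc₂ (by linarith) (hL.mono hκ hN0 (by linarith))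
    have e1 := hS.sum_m k (hN₀.trans hk)
    have e2 := hM k hk
    have e3 := hM (k + 1) (by omega)
    rw [← heq, show (k:ℝ) + α / 2 + 1 / 2 - 1 / 2 = (k:ℝ) + α / 2 by ring,
      show (k:ℝ) + α / 2 + 1 / 2 + 1 / 2 = ((k + 1 : ℕ):ℝ) + α / 2 by push_cast; ring,
      inv_inv, ← e1] at hst
    have hm0 := hmp k (by omega)
    have hm1 := hmp (k + 1) (by omega)
    have h4 : 4 ≤ (m k + m (k + 1)) * ((m k)⁻¹ + (m (k + 1))⁻¹) := by
      have := four_div_add_le hm0 hm1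
      rwa [div_le_iff₀' (by positivity)] at this
    have h5 := mul_le_mul_of_nonneg_left (add_le_add e2 e3) (add_pos hm0 hm1).le
    linarith
  · have heq : (m k)⁻¹ = upperInvM κ R (R * c₁) (R * c₂) ((k:ℝ) + α / 2) := by
      have h1 : R = (m k)⁻¹ / upperInvM κ 1 c₁ c₂ ((k:ℝ) + α / 2) := hc
      rw [eq_div_iff (hMpos k).ne', hMs] at h1
      exact h1.symm
    have hkne : k ≠ N₀ := by
      rintro rfl
      have h1 : R = (m k)⁻¹ / upperInvM κ 1 c₁ c₂ ((k:ℝ) + α / 2) := hc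
      rw [h1, one_lt_div (hMpos k)] at hk1
      linarith
    obtain ⟨j, rfl⟩ : ∃ j, k = j + 1 := ⟨k - 1, by omega⟩
    have hmg := hS.m_gt (j + 1) (by omega)
    have hm0 := hmp (j + 1) (by omega)
    have hm2 : 0 < m (j + 1) ^ 2 - t ^ 2 / 4 := by nlinarith
    have hst := upperInvM_strict (s := ((j + 1 : ℕ):ℝ) + α / 2) hκ hG hk1.le hRc₁ hRc₂
      (by linarith) (hL.mono hκ hN0 (by linarith)) (by rw [← heq, inv_inv]; linarith)
    have e1 := hS.sum_inv_a j
    have e2 := hA j (by omega)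
    have e3 := hA (j + 1) (by omega)
    rw [← heq, show ((j + 1 : ℕ):ℝ) + α / 2 - 1 / 2 = (j:ℝ) + α / 2 + 1 / 2 by push_cast; ring,
      inv_inv, show α * t / (2 * κ ^ 2) * κ ^ 2 = α * t / 2 by field_simp, hκ3] at hst
    have h7 := mul_le_mul_of_nonneg_right (add_le_add e3 e2) hm2.le
    rw [e1] at h7
    push_cast at hst h7
    linarith

end

theorem le_mul_of_forall_pos {x y z w : ℝ} (hy : 0 < y) (hw : 0 < w)
    (h : ∀ ε > 0, x ≤ y * (z + ε * w)) : x ≤ y * z := by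
  refine le_of_forall_pos_le_add fun ε hε => ?_
  have := h (ε / (y * w)) (by positivity)
  have e : y * (z + ε / (y * w) * w) = y * z + ε := by field_simp
  linarith

theorem tendsto_add_rpow_third (β : ℝ) :
    Filter.Tendsto (fun n : ℕ => ((n:ℝ) + β) ^ ((1:ℝ) / 3)) Filter.atTop Filter.atTop :=
  (tendsto_rpow_atTop (by norm_num)).comp
    (Filter.tendsto_atTop_add_const_right _ _ tendsto_natCast_atTop_atTop)

section

variable {α t κ K₀ : ℝ} {a m : ℕ → ℝ}

theorem IsPositiveSolution.eventually_le_barriers (hS : IsPositiveSolution α t a m) (hα : 0 < α)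
    (ht : 0 < t) (hκ : 0 < κ) (ha : ∀ n, a n ≤ K₀) {c₁ c₂ : ℝ} (h₁ : 0 ≤ c₁) (h₂ : 0 < c₂) :
    ∃ N, ∀ n ≥ N, (a n ≤ upperA κ 1 c₁ c₂ ((n:ℝ) + α / 2 + 1 / 2) ∧
      m n ≤ upperM κ 1 c₁ c₂ ((n:ℝ) + α / 2)) ∧
      (a n)⁻¹ ≤ upperInvA κ 1 c₁ c₂ ((n:ℝ) + α / 2 + 1 / 2) ∧
      (m n)⁻¹ ≤ upperInvM κ 1 c₁ c₂ ((n:ℝ) + α / 2) := by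
  have hK₀ : 0 < K₀ := (hS.a_pos 0).trans_le (ha 0)
  set T := max 1 (max ((3 * K₀ + K₀ ^ 2 + K₀) / (κ * c₂)) ((2 + K₀) / t * (κ / c₂))) with hT
  obtain ⟨N, hN⟩ := Filter.eventually_atTop.mp
    ((tendsto_add_rpow_third (α / 2)).eventually_ge_atTop T)
  refine ⟨max N 1, fun n hn => ?_⟩
  have hn1 : 1 ≤ n := (le_max_right _ _).trans hn
  have hn1' : (1:ℝ) ≤ n := by exact_mod_cast hn1
  have hσT := hN n ((le_max_left _ _).trans hn)
  have hτσ : ((n:ℝ) + α / 2) ^ ((1:ℝ) / 3) ≤ ((n:ℝ) + α / 2 + 1 / 2) ^ ((1:ℝ) / 3) :=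
    Real.rpow_le_rpow (by positivity) (by linarith) (by norm_num)
  have hs3 := rpow_third_pow (s := (n:ℝ) + α / 2) (by positivity)
  have hs3' := rpow_third_pow (s := (n:ℝ) + α / 2 + 1 / 2) (by positivity)
  have a_pos := hS.a_pos n
  have m_gt := hS.m_gt n hn1
  have m_gt' := hS.m_gt (n + 1) (by omega)
  have e1 := hS.sum_m n hn1
  have han := ha n
  unfold upperA upperM upperInvA upperInvM
  set σ := ((n:ℝ) + α / 2) ^ ((1:ℝ) / 3)
  set τ := ((n:ℝ) + α / 2 + 1 / 2) ^ ((1:ℝ) / 3)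
  have g0 : 1 ≤ T := le_max_left _ _
  have hσ1 : 1 ≤ σ := g0.trans hσT
  have hτ1 : 1 ≤ τ := hσ1.trans hτσ
  have hσ : 0 < σ := by linarith
  have hτ : 0 < τ := by linarith
  have g1 : 3 * K₀ + K₀ ^ 2 + K₀ ≤ κ * c₂ * σ := by
    have : (3 * K₀ + K₀ ^ 2 + K₀) / (κ * c₂) ≤ T := (le_max_left _ _).trans (le_max_right _ _)
    rw [div_le_iff₀ (by positivity)] at this
    nlinarith [mul_pos hκ h₂]
  have g2 : (2 + K₀) / t * (κ / c₂) ≤ σ :=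
    ((le_max_right _ _).trans (le_max_right _ _)).trans hσT
  have g2' : (2 + K₀) / t ≤ κ⁻¹ * c₂ * σ := by
    calc (2 + K₀) / t = κ⁻¹ * c₂ * ((2 + K₀) / t * (κ / c₂)) := by field_simp
      _ ≤ _ := by gcongr
  have hb : ∀ x > 0, c₂ * x ^ 3 ≤ barrierFactor 1 c₁ c₂ x := fun x hx => by
    unfold barrierFactor
    have : 0 ≤ c₁ / x := by positivity
    linarith
  have hs1 : 1 ≤ (n:ℝ) + α / 2 := by linarith
  have i1 : a n ≤ κ * τ⁻¹ * (c₂ * τ ^ 3) := by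
    have : κ * τ⁻¹ * (c₂ * τ ^ 3) = κ * c₂ * τ * τ := by field_simp
    have h2 : κ * c₂ * σ ≤ κ * c₂ * τ * τ := by
      calc κ * c₂ * σ ≤ κ * c₂ * τ := by gcongr
        _ ≤ κ * c₂ * τ * τ := le_mul_of_one_le_right (by positivity) hτ1
    nlinarith [sq_nonneg K₀]
  have i2 : m n ≤ κ * σ ^ 2 * (c₂ * σ ^ 3) := by
    have : κ * σ ^ 2 * (c₂ * σ ^ 3) = κ * c₂ * σ * σ * ((n:ℝ) + α / 2) := by rw [← hs3]; ring
    have h2 : κ * c₂ * σ ≤ κ * c₂ * σ * σ := le_mul_of_one_le_right (by positivity) hσ1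
    have h3 : m n ≤ (3 * K₀ + K₀ ^ 2) * ((n:ℝ) + α / 2) := by
      calc m n ≤ 2 * ((n:ℝ) + α / 2 + 1 / 2) * a n + a n ^ 2 := by linarith
        _ ≤ 2 * ((n:ℝ) + α / 2 + 1 / 2) * K₀ + K₀ ^ 2 := by gcongr
        _ ≤ _ := by nlinarith [sq_nonneg K₀]
    rw [this]
    refine h3.trans ?_
    gcongr
    linarith
  have i3 : (a n)⁻¹ ≤ κ⁻¹ * τ * (c₂ * τ ^ 3) := by
    have h3 : (a n)⁻¹ ≤ (2 + K₀) / t * ((n:ℝ) + α / 2 + 1 / 2) := by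
      rw [inv_le_iff_one_le_mul₀ a_pos, div_mul_eq_mul_div, div_mul_eq_mul_div, le_div_iff₀ ht]
      nlinarith [mul_nonneg hK₀.le a_pos.le]
    calc (a n)⁻¹ ≤ (2 + K₀) / t * ((n:ℝ) + α / 2 + 1 / 2) := h3
      _ ≤ κ⁻¹ * c₂ * τ * ((n:ℝ) + α / 2 + 1 / 2) := by
        gcongr
        exact g2'.trans (by gcongr)
      _ = _ := by rw [← hs3']; ring
  have i4 : (m n)⁻¹ ≤ κ⁻¹ * (σ ^ 2)⁻¹ * (c₂ * σ ^ 3) := by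
    have : κ⁻¹ * (σ ^ 2)⁻¹ * (c₂ * σ ^ 3) = κ⁻¹ * c₂ * σ := by field_simp
    rw [this]
    refine le_trans ?_ g2'
    rw [inv_le_iff_one_le_mul₀ (by linarith), div_mul_eq_mul_div, le_div_iff₀ ht]
    nlinarith
  refine ⟨⟨i1.trans ?_, i2.trans ?_⟩, i3.trans ?_, i4.trans ?_⟩
  · gcongr; exact hb τ hτ
  · gcongr
    · exact le_add_of_nonneg_right (by positivity)
    · exact hb σ hσ
  · gcongr
    · exact le_add_of_nonneg_right (by positivity)
    · exact hb τ hτ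
  · gcongr; exact hb σ hσ

theorem IsPositiveSolution.exists_barriers (hS : IsPositiveSolution α t a m) (hα : 0 < α)
    (ht : 0 < t) (hκ : 0 < κ) (hκ3 : κ ^ 3 = t ^ 2 / 2) (ha : ∀ n, a n ≤ K₀) :
    ∃ c > 0, ∃ N ≥ 1, ∀ n ≥ N, (a n ≤ upperA κ 1 c 0 ((n:ℝ) + α / 2 + 1 / 2) ∧
      m n ≤ upperM κ 1 c 0 ((n:ℝ) + α / 2)) ∧
      (a n)⁻¹ ≤ upperInvA κ 1 c 0 ((n:ℝ) + α / 2 + 1 / 2) ∧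
      (m n)⁻¹ ≤ upperInvM κ 1 c 0 ((n:ℝ) + α / 2) := by
  obtain ⟨N, hN1, hL⟩ : ∃ N : ℕ, 1 ≤ N ∧ LargeFor κ ((N:ℝ) + α / 2) := by
    obtain ⟨N, hN⟩ := Filter.eventually_atTop.mp
      ((tendsto_add_rpow_third (α / 2)).eventually_ge_atTop (max 1 (max κ (17 / κ))))
    refine ⟨max N 1, le_max_right _ _, ?_⟩
    have := hN (max N 1) (le_max_left _ _)
    rw [max_le_iff, max_le_iff, div_le_iff₀ hκ] at this
    exact ⟨this.1, this.2.1, by linarith [this.2.2]⟩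
  set c := max (α * t / (2 * κ ^ 2) + 1) (max (m N / κ) (κ * ((N:ℝ) + α / 2) / m N)) with hc
  have hc1 : α * t / (2 * κ ^ 2) + 1 ≤ c := le_max_left _ _
  have hc2 : m N / κ ≤ c := (le_max_left _ _).trans (le_max_right _ _)
  have hc3 : κ * ((N:ℝ) + α / 2) / m N ≤ c := (le_max_right _ _).trans (le_max_right _ _)
  have hc0 : 1 ≤ c := by
    have : 0 ≤ α * t / (2 * κ ^ 2) := by positivity
    linarith
  have hm : 0 < m N := by linarith [hS.m_gt N hN1]
  have hNσ : 1 ≤ ((N:ℝ) + α / 2) ^ ((1:ℝ) / 3) := hL.1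
  have hs3 := rpow_third_pow (s := (N:ℝ) + α / 2) (by positivity)
  have hstart : ∀ ε > 0, m N ≤ upperM κ 1 c ε ((N:ℝ) + α / 2) := fun ε hε => by
    unfold upperM barrierFactor
    set σ := ((N:ℝ) + α / 2) ^ ((1:ℝ) / 3)
    have hσ : 0 < σ := by linarith
    rw [div_le_iff₀ hκ] at hc2
    calc m N ≤ κ * c := by linarith
      _ ≤ κ * c * σ := le_mul_of_one_le_right (by positivity) hNσ
      _ = κ * σ ^ 2 * (c / σ) := by field_simp
      _ ≤ _ := by
        gcongr
        · exact le_add_of_nonneg_right (by positivity)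
        · have : 0 ≤ ε * σ ^ 3 := by positivity
          linarith
  have hstart' : ∀ ε > 0, (m N)⁻¹ ≤ upperInvM κ 1 c ε ((N:ℝ) + α / 2) := fun ε hε => by
    unfold upperInvM barrierFactor
    set σ := ((N:ℝ) + α / 2) ^ ((1:ℝ) / 3)
    have hσ : 0 < σ := by linarith
    rw [← hs3] at hc3
    calc (m N)⁻¹ = (κ * σ ^ 3)⁻¹ * (κ * σ ^ 3 / m N) := by field_simp
      _ ≤ (κ * σ ^ 3)⁻¹ * c := by gcongr
      _ = κ⁻¹ * (σ ^ 2)⁻¹ * (c / σ) := by field_simp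
      _ ≤ _ := by
        gcongr
        have : 0 ≤ ε * σ ^ 3 := by positivity
        linarith
  refine ⟨c, by linarith, N, hN1, fun n hn => ?_⟩
  have hup : ∀ ε : ℝ, 0 < ε → _ := fun (ε : ℝ) (hε : 0 < ε) =>
    hS.le_upper hα ht hκ hκ3 hN1 hL hc0 hε.le (hstart ε hε)
      ((hS.eventually_le_barriers hα ht hκ ha (by linarith) hε).imp
        fun _ hM k hk => (hM k hk).1) n hn
  have hlow : ∀ ε : ℝ, 0 < ε → _ := fun (ε : ℝ) (hε : 0 < ε) =>
    hS.inv_le_upper hα ht hκ hκ3 hN1 hL hc1 hε.le (hstart' ε hε)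
      ((hS.eventually_le_barriers hα ht hκ ha (by linarith) hε).imp
        fun _ hM k hk => (hM k hk).2) n hn
  have hσ : 0 < ((n:ℝ) + α / 2) ^ ((1:ℝ) / 3) := by positivity
  have hτ : 0 < ((n:ℝ) + α / 2 + 1 / 2) ^ ((1:ℝ) / 3) := by positivity
  have hz : ∀ x, barrierFactor 1 c 0 x = 1 + c / x := fun x => by unfold barrierFactor; ring
  unfold upperA upperM upperInvA upperInvM at *
  simp only [hz]
  refine ⟨⟨le_mul_of_forall_pos (by positivity) (pow_pos hτ 3) fun ε hε => (hup ε hε).1,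
    le_mul_of_forall_pos (by positivity) (pow_pos hσ 3) fun ε hε => (hup ε hε).2⟩,
    le_mul_of_forall_pos (by positivity) (pow_pos hτ 3) fun ε hε => (hlow ε hε).1,
    le_mul_of_forall_pos (by positivity) (pow_pos hσ 3) fun ε hε => (hlow ε hε).2⟩

theorem sub_le_of_inv_le_upperInvA {κ c τ a : ℝ} (hκ : 0 < κ) (hc : 0 < c) (hτ1 : 1 ≤ τ)
    (a_pos : 0 < a)
    (l1 : a⁻¹ ≤ (κ⁻¹ * τ + 1 / 2 * (τ ^ 3)⁻¹) * (1 + c / τ)) :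
    κ * τ⁻¹ - κ * (c + κ / 2) * (τ ^ 2)⁻¹ ≤ a := by
  have hτ : 0 < τ := by linarith
  have h1 : 1 ≤ a * ((κ⁻¹ * τ + 1 / 2 * (τ ^ 3)⁻¹) * (1 + c / τ)) := by
    rwa [inv_le_iff_one_le_mul₀' a_pos] at l1
  have h2 : (κ⁻¹ * τ + 1 / 2 * (τ ^ 3)⁻¹) * (1 + c / τ) * (1 - (c + κ / 2) / τ) ≤ κ⁻¹ * τ := by
    have e : κ⁻¹ * τ - (κ⁻¹ * τ + 1 / 2 * (τ ^ 3)⁻¹) * (1 + c / τ) * (1 - (c + κ / 2) / τ)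
      = ((κ * τ ^ 4 * (τ - 1) + κ * τ ^ 4 - κ * τ ^ 2) + 2 * c * τ ^ 4 * (c + κ / 2)
         + κ * τ * (κ / 2) + c * κ * (c + κ / 2)) / (2 * κ * τ ^ 5) := by
      field_simp
      ring
    have p4 : τ ^ 2 ≤ τ ^ 4 := pow_le_pow_right₀ hτ1 (by norm_num)
    have : 0 ≤ κ * τ ^ 4 * (τ - 1) := mul_nonneg (by positivity) (by linarith)
    have : 0 ≤ κ * τ ^ 4 - κ * τ ^ 2 := by nlinarith
    have : 0 ≤ ((κ * τ ^ 4 * (τ - 1) + κ * τ ^ 4 - κ * τ ^ 2) + 2 * c * τ ^ 4 * (c + κ / 2)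
         + κ * τ * (κ / 2) + c * κ * (c + κ / 2)) / (2 * κ * τ ^ 5) := by
      apply div_nonneg _ (by positivity)
      have : 0 ≤ 2 * c * τ ^ 4 * (c + κ / 2) + κ * τ * (κ / 2) + c * κ * (c + κ / 2) := by
        positivity
      linarith
    linarith
  have e : κ * τ⁻¹ - κ * (c + κ / 2) * (τ ^ 2)⁻¹ = κ * τ⁻¹ * (1 - (c + κ / 2) / τ) := by
    field_simp
  rw [e]
  rcases le_total (1 - (c + κ / 2) / τ) 0 with h0 | h0
  · exact (mul_nonpos_of_nonneg_of_nonpos (by positivity) h0).trans a_pos.le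
  · have h3 := mul_le_mul_of_nonneg_right h1 h0
    have h4 := mul_le_mul_of_nonneg_left h2 a_pos.le
    calc κ * τ⁻¹ * (1 - (c + κ / 2) / τ) ≤ κ * τ⁻¹ * (a * (κ⁻¹ * τ)) := by
          gcongr
          linarith
      _ = a := by field_simp

theorem upperM_le {κ c σ : ℝ} (hκ : 0 < κ) (hc : 0 < c) (hσ1 : 1 ≤ σ) :
    (κ * σ ^ 2 + κ ^ 2 / 2 * (σ ^ 2)⁻¹) * (1 + c / σ) ≤
      κ * σ ^ 2 + (κ * c + κ ^ 2 / 2 * (1 + c)) * σ := by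
  have hσ : 0 < σ := by linarith
  have e : (κ * σ ^ 2 + κ ^ 2 / 2 * (σ ^ 2)⁻¹) * (1 + c / σ) =
    κ * σ ^ 2 + κ * c * σ + κ ^ 2 / 2 * ((σ ^ 2)⁻¹ * (1 + c / σ)) := by
    field_simp
  have : (σ ^ 2)⁻¹ * (1 + c / σ) ≤ 1 * (1 + c) := by
    gcongr
    · exact inv_le_one_of_one_le₀ (one_le_pow₀ hσ1)
    · exact div_le_self hc.le hσ1
  have h2 : (1 + c) ≤ (1 + c) * σ := le_mul_of_one_le_right (by positivity) hσ1
  have h3 : κ ^ 2 / 2 * ((σ ^ 2)⁻¹ * (1 + c / σ)) ≤ κ ^ 2 / 2 * ((1 + c) * σ) := by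
    refine mul_le_mul_of_nonneg_left ?_ (by positivity)
    rw [one_mul] at this
    exact this.trans h2
  linarith

theorem sub_le_of_inv_le_upperInvM {κ c σ m : ℝ} (hκ : 0 < κ) (hσ1 : 1 ≤ σ) (m_pos : 0 < m)
    (l2 : m⁻¹ ≤ κ⁻¹ * (σ ^ 2)⁻¹ * (1 + c / σ)) : κ * σ ^ 2 - κ * c * σ ≤ m := by
  have hσ : 0 < σ := by linarith
  have h1 : 1 ≤ m * (κ⁻¹ * (σ ^ 2)⁻¹ * (1 + c / σ)) := by
    rwa [inv_le_iff_one_le_mul₀' m_pos] at l2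
  have e : κ * σ ^ 2 - κ * c * σ = κ * σ ^ 2 * (1 - c / σ) := by field_simp
  rw [e]
  rcases le_total (1 - c / σ) 0 with h0 | h0
  · exact (mul_nonpos_of_nonneg_of_nonpos (by positivity) h0).trans m_pos.le
  · have h3 := mul_le_mul_of_nonneg_right h1 h0
    calc κ * σ ^ 2 * (1 - c / σ) ≤ κ * σ ^ 2 *
          (m * (κ⁻¹ * (σ ^ 2)⁻¹ * (1 + c / σ)) * (1 - c / σ)) := by
          gcongr
          linarith
      _ = m * (1 - (c / σ) ^ 2) := by field_simp; ring
      _ ≤ m := by nlinarith [sq_nonneg (c / σ)]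

/-- The asymptotics of positive solutions, in terms of `n ^ (1 / 3)`. -/
theorem IsPositiveSolution.asymptotics (hS : IsPositiveSolution α t a m) (hα : 0 < α)
    (ht : 0 < t) (hκ : 0 < κ) (hκ3 : κ ^ 3 = t ^ 2 / 2) (ha : ∀ n, a n ≤ K₀) :
    ∃ C > 0, ∃ N ≥ 1, ∀ n ≥ N,
      |a n - κ / (n:ℝ) ^ ((1:ℝ) / 3)| ≤ C / ((n:ℝ) ^ ((1:ℝ) / 3)) ^ 2 ∧
      |m n - κ * ((n:ℝ) ^ ((1:ℝ) / 3)) ^ 2| ≤ C * (n:ℝ) ^ ((1:ℝ) / 3) := by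
  obtain ⟨c, hc, N, hN1, hN⟩ := hS.exists_barriers hα ht hκ hκ3 ha
  refine ⟨κ * (c + κ / 2) + κ * (α / 2 + 1 / 2) + (κ * c + κ ^ 2 / 2 * (1 + c)) * (1 + α / 2)
    + κ * (α / 2), by positivity, N, hN1, fun n hn => ?_⟩
  obtain ⟨⟨u1, u2⟩, l1, l2⟩ := hN n hn
  have hn1' : (1:ℝ) ≤ n := by exact_mod_cast hN1.trans hn
  have hρ1 : 1 ≤ (n:ℝ) ^ ((1:ℝ) / 3) := Real.one_le_rpow hn1' (by norm_num)
  have hs3 := rpow_third_pow (s := (n:ℝ) + α / 2) (by positivity)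
  have hs3' := rpow_third_pow (s := (n:ℝ) + α / 2 + 1 / 2) (by positivity)
  have hs3'' := rpow_third_pow (s := (n:ℝ)) (by positivity)
  have a_pos := hS.a_pos n
  have m_pos : 0 < m n := by linarith [hS.m_gt n (hN1.trans hn)]
  have hρσ : (n:ℝ) ^ ((1:ℝ) / 3) ≤ ((n:ℝ) + α / 2) ^ ((1:ℝ) / 3) :=
    Real.rpow_le_rpow (by positivity) (by linarith) (by norm_num)
  have hρτ : (n:ℝ) ^ ((1:ℝ) / 3) ≤ ((n:ℝ) + α / 2 + 1 / 2) ^ ((1:ℝ) / 3) :=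
    Real.rpow_le_rpow (by positivity) (by linarith) (by norm_num)
  unfold upperA upperM upperInvA upperInvM barrierFactor at *
  simp only [zero_mul, add_zero] at u1 u2 l1 l2
  set ρ := (n:ℝ) ^ ((1:ℝ) / 3)
  set σ := ((n:ℝ) + α / 2) ^ ((1:ℝ) / 3)
  set τ := ((n:ℝ) + α / 2 + 1 / 2) ^ ((1:ℝ) / 3)
  have hρ : 0 < ρ := by linarith
  have hσ1 : 1 ≤ σ := hρ1.trans hρσ
  have hτ1 : 1 ≤ τ := hρ1.trans hρτ
  have hσ : 0 < σ := by linarith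
  have hτ : 0 < τ := by linarith
  have dσ : (σ - ρ) * (σ ^ 2 + σ * ρ + ρ ^ 2) = α / 2 := by linear_combination hs3 - hs3''
  have dτ : (τ - ρ) * (τ ^ 2 + τ * ρ + ρ ^ 2) = α / 2 + 1 / 2 := by
    linear_combination hs3' - hs3''
  have dτ1 : τ - ρ ≤ α / 2 + 1 / 2 := by
    rw [← dτ]
    refine le_mul_of_one_le_right (by linarith) ?_
    linarith [one_le_pow₀ (n := 2) hτ1, mul_pos hτ hρ, pow_pos hρ 2]
  have dσ1 : σ - ρ ≤ α / 2 := by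
    rw [← dσ]
    refine le_mul_of_one_le_right (by linarith) ?_
    linarith [one_le_pow₀ (n := 2) hσ1, mul_pos hσ hρ, pow_pos hρ 2]
  have dσ2 : σ ^ 2 - ρ ^ 2 ≤ α / 2 := by
    rw [← dσ, show σ ^ 2 - ρ ^ 2 = (σ - ρ) * (σ + ρ) by ring]
    refine mul_le_mul_of_nonneg_left ?_ (by linarith)
    linarith [le_self_pow₀ hσ1 two_ne_zero, le_self_pow₀ hρ1 two_ne_zero, mul_pos hσ hρ]
  have iτ : ρ⁻¹ - τ⁻¹ ≤ (α / 2 + 1 / 2) * (ρ ^ 2)⁻¹ := by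
    have : ρ⁻¹ - τ⁻¹ = (τ - ρ) * (τ⁻¹ * ρ⁻¹) := by field_simp
    rw [this]
    have : τ⁻¹ ≤ ρ⁻¹ := inv_anti₀ hρ hρτ
    calc (τ - ρ) * (τ⁻¹ * ρ⁻¹) ≤ (α / 2 + 1 / 2) * (ρ⁻¹ * ρ⁻¹) := by gcongr
      _ = _ := by rw [sq, mul_inv]
  have iτ0 : τ⁻¹ ≤ ρ⁻¹ := inv_anti₀ hρ hρτ
  have iτ2 : (τ ^ 2)⁻¹ ≤ (ρ ^ 2)⁻¹ := inv_anti₀ (by positivity) (by gcongr)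
  have a_up : a n ≤ κ * τ⁻¹ + κ * c * (τ ^ 2)⁻¹ := by
    refine u1.trans_eq ?_
    field_simp
  have a_low := sub_le_of_inv_le_upperInvA hκ hc hτ1 a_pos l1
  have m_up := u2.trans (upperM_le hκ hc hσ1)
  have m_low := sub_le_of_inv_le_upperInvM hκ hσ1 m_pos l2
  have hσρ : σ ≤ (1 + α / 2) * ρ := by
    linarith [mul_le_mul_of_nonneg_left hρ1 (half_pos hα).le]
  set D₁ := κ * (c + κ / 2)
  set D₂ := κ * c + κ ^ 2 / 2 * (1 + c)
  have hD₁ : 0 ≤ D₁ := by positivity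
  have hD₂ : 0 ≤ D₂ := by positivity
  have hρi : 0 < (ρ ^ 2)⁻¹ := by positivity
  constructor
  · rw [div_eq_mul_inv, div_eq_mul_inv, abs_le]
    have j1 : κ * c * (τ ^ 2)⁻¹ ≤ D₁ * (ρ ^ 2)⁻¹ := by
      refine mul_le_mul ?_ iτ2 (by positivity) hD₁
      exact mul_le_mul_of_nonneg_left (by linarith) hκ.le
    have j2 : D₁ * (τ ^ 2)⁻¹ ≤ D₁ * (ρ ^ 2)⁻¹ := mul_le_mul_of_nonneg_left iτ2 hD₁
    have j3 := mul_le_mul_of_nonneg_left iτ hκ.le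
    have j4 := mul_le_mul_of_nonneg_left iτ0 hκ.le
    have j5 : 0 ≤ D₂ * (1 + α / 2) * (ρ ^ 2)⁻¹ := by positivity
    have j6 : 0 ≤ κ * (α / 2) * (ρ ^ 2)⁻¹ := by positivity
    have j7 : 0 ≤ κ * (α / 2 + 1 / 2) * (ρ ^ 2)⁻¹ := by positivity
    constructor <;> linarith
  · rw [abs_le]
    have j1 : D₂ * σ ≤ D₂ * ((1 + α / 2) * ρ) := mul_le_mul_of_nonneg_left hσρ hD₂
    have j2 : κ * c * σ ≤ D₂ * σ := by
      gcongr
      exact le_add_of_nonneg_right (by positivity)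
    have j3 : κ * (σ ^ 2 - ρ ^ 2) ≤ κ * (α / 2) * ρ := by
      calc κ * (σ ^ 2 - ρ ^ 2) ≤ κ * (α / 2) := by gcongr
        _ ≤ _ := le_mul_of_one_le_right (by positivity) hρ1
    have j4 : κ * ρ ^ 2 ≤ κ * σ ^ 2 := by gcongr
    have j5 : 0 ≤ D₁ * ρ := by positivity
    have j6 : 0 ≤ κ * (α / 2) * ρ := by positivity
    have j7 : 0 ≤ κ * (α / 2 + 1 / 2) * ρ := by positivity
    constructor <;> linarith

end

theorem sum_asymptotics {a : ℕ → ℝ} {κ C : ℝ} {N : ℕ} (hN1 : 1 ≤ N) (hC : 0 < C) (hκ : 0 < κ)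
    (h : ∀ n ≥ N, |a n - κ / (n:ℝ) ^ ((1:ℝ) / 3)| ≤ C / ((n:ℝ) ^ ((1:ℝ) / 3)) ^ 2) :
    ∃ C' > 0, ∀ n ≥ N, |∑ j ∈ Finset.range n, a j - 3 / 2 * κ * ((n:ℝ) ^ ((1:ℝ) / 3)) ^ 2|
      ≤ C' * (n:ℝ) ^ ((1:ℝ) / 3) := by
  set D := |∑ j ∈ Finset.range N, a j - 3 / 2 * κ * ((N:ℝ) ^ ((1:ℝ) / 3)) ^ 2| with hD
  refine ⟨12 * (C + κ) + D, by positivity, fun n hn => ?_⟩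
  induction n, hn using Nat.le_induction with
  | base =>
    have : (1:ℝ) ≤ (N:ℝ) ^ ((1:ℝ) / 3) :=
      Real.one_le_rpow (by exact_mod_cast hN1) (by norm_num)
    rw [← hD]
    nlinarith [abs_nonneg (∑ j ∈ Finset.range N, a j - 3 / 2 * κ * ((N:ℝ) ^ ((1:ℝ) / 3)) ^ 2)]
  | succ n hn ih =>
    rw [Finset.sum_range_succ]
    have hn1 : (1:ℝ) ≤ n := by exact_mod_cast hN1.trans hn
    have hρ1 : 1 ≤ (n:ℝ) ^ ((1:ℝ) / 3) := Real.one_le_rpow hn1 (by norm_num)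
    have h3 := rpow_third_pow (s := (n:ℝ)) (by positivity)
    have h3' := rpow_third_pow (s := ((n + 1 : ℕ):ℝ)) (by positivity)
    have hρσ : (n:ℝ) ^ ((1:ℝ) / 3) ≤ ((n + 1 : ℕ):ℝ) ^ ((1:ℝ) / 3) :=
      Real.rpow_le_rpow (by positivity) (by push_cast; linarith) (by norm_num)
    have hn' := h n hn
    set ρ := (n:ℝ) ^ ((1:ℝ) / 3)
    set σ := ((n + 1 : ℕ):ℝ) ^ ((1:ℝ) / 3)
    have hρ : 0 < ρ := by linarith
    push_cast at h3'
    have d : (σ - ρ) * (σ ^ 2 + σ * ρ + ρ ^ 2) = 1 := by linear_combination h3' - h3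
    have d0 : 0 ≤ σ - ρ := by linarith
    have d1 : (σ - ρ) * (3 * ρ ^ 2) ≤ 1 := by
      rw [← d]; exact mul_le_mul_of_nonneg_left (by nlinarith) d0
    have hσ2 : σ ≤ 2 * ρ := by nlinarith
    have d2 : 1 ≤ (σ - ρ) * (12 * ρ ^ 2) := by
      rw [← d]; exact mul_le_mul_of_nonneg_left (by nlinarith) d0
    have i2 : (ρ ^ 2)⁻¹ ≤ 12 * (σ - ρ) := by
      rw [inv_le_iff_one_le_mul₀ (by positivity)]; linarith
    have mid : |κ / ρ - 3 / 2 * κ * (σ ^ 2 - ρ ^ 2)| ≤ κ * (ρ ^ 2)⁻¹ := by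
      have e : κ / ρ - 3 / 2 * κ * (σ ^ 2 - ρ ^ 2) =
          κ * ((σ - ρ) ^ 2 * (2 * σ + ρ) / (2 * ρ)) := by
        have : κ / ρ = κ / ρ * ((σ - ρ) * (σ ^ 2 + σ * ρ + ρ ^ 2)) := by rw [d, mul_one]
        rw [this]
        field_simp
        ring
      rw [e, abs_of_nonneg (by positivity)]
      gcongr
      rw [div_le_iff₀ (by positivity)]
      have : (ρ ^ 2)⁻¹ * (2 * ρ) = 2 * ρ⁻¹ := by field_simp
      rw [this]
      have k1 : σ - ρ ≤ ρ⁻¹ := by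
        rw [inv_eq_one_div, le_div_iff₀ hρ]
        nlinarith [mul_nonneg d0 hρ.le]
      calc (σ - ρ) ^ 2 * (2 * σ + ρ) = (σ - ρ) * ((σ - ρ) * (2 * σ + ρ)) := by ring
        _ ≤ ρ⁻¹ * 2 := by
          gcongr
          nlinarith
        _ = _ := mul_comm _ _
    have key : ∑ j ∈ Finset.range n, a j + a n - 3 / 2 * κ * σ ^ 2 =
        (∑ j ∈ Finset.range n, a j - 3 / 2 * κ * ρ ^ 2) +
          ((a n - κ / ρ) + (κ / ρ - 3 / 2 * κ * (σ ^ 2 - ρ ^ 2))) := by ring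
    rw [key]
    have hD0 : 0 ≤ D * (σ - ρ) := mul_nonneg (abs_nonneg _) d0
    have i3 : (C + κ) * (ρ ^ 2)⁻¹ ≤ (C + κ) * (12 * (σ - ρ)) := by gcongr
    rw [div_eq_mul_inv _ (ρ ^ 2)] at hn'
    linarith [abs_add_le (∑ j ∈ Finset.range n, a j - 3 / 2 * κ * ρ ^ 2)
      ((a n - κ / ρ) + (κ / ρ - 3 / 2 * κ * (σ ^ 2 - ρ ^ 2))),
      abs_add_le (a n - κ / ρ) (κ / ρ - 3 / 2 * κ * (σ ^ 2 - ρ ^ 2))]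

open Polynomial in
/-- The functional `q ↦ ∫ q(x) x^{-i} w(x) dx`. -/
noncomputable def weightFunctional (α t : ℝ) (i : ℕ) (q : ℝ[X]) : ℝ :=
  ∫ x in Ioi (0:ℝ), q.eval x / x ^ i * pertLagWeight α t x

theorem pertLagWeight_pos {α t x : ℝ} (hx : 0 < x) : 0 < pertLagWeight α t x := by
  unfold pertLagWeight
  positivity

theorem continuousOn_pertLagWeight (α t : ℝ) : ContinuousOn (pertLagWeight α t) (Ioi 0) := by
  intro x hx
  have hx : x ≠ 0 := ne_of_gt hx
  refine ContinuousAt.continuousWithinAt ?_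
  unfold pertLagWeight
  fun_prop (disch := simp [hx])

theorem integrableOn_pow_mul_pertLagWeight {α t : ℝ} (hα : 0 < α) (ht : 0 < t) (i k : ℕ) :
    IntegrableOn (fun x => x ^ k / x ^ i * pertLagWeight α t x) (Ioi 0) := by
  have h := (Real.GammaIntegral_convergent (s := k + α + 1) (by positivity)).const_mul
    ((i.factorial : ℝ) / t ^ i)
  refine h.mono' (ContinuousOn.aestronglyMeasurable ?_ measurableSet_Ioi) ?_
  · refine ContinuousOn.mul (ContinuousOn.div (by fun_prop) (by fun_prop) fun x hx => ?_)
      (continuousOn_pertLagWeight α t)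
    exact pow_ne_zero _ (ne_of_gt hx)
  · refine (ae_restrict_mem measurableSet_Ioi).mono fun x (hx : 0 < x) => ?_
    have hw := pertLagWeight_pos (α := α) (t := t) hx
    rw [Real.norm_of_nonneg (by positivity)]
    have hexp : (t / x) ^ i ≤ i.factorial * Real.exp (t / x) := by
      have := Real.pow_div_factorial_le_exp (t / x) (by positivity) i
      rwa [div_le_iff₀' (by positivity)] at this
    have h1 : Real.exp (-(t / x)) / x ^ i ≤ i.factorial / t ^ i := by
      rw [div_le_div_iff₀ (by positivity) (by positivity), Real.exp_neg,
        inv_mul_le_iff₀ (Real.exp_pos _)]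
      rw [div_pow, div_le_iff₀ (by positivity)] at hexp
      linarith
    have h2 : x ^ ((k:ℝ) + α + 1 - 1) = x ^ k * x ^ α := by
      rw [add_sub_cancel_right, Real.rpow_add hx, Real.rpow_natCast]
    rw [h2]
    calc x ^ k / x ^ i * pertLagWeight α t x
        = Real.exp (-(t / x)) / x ^ i * (Real.exp (-x) * (x ^ k * x ^ α)) := by
          unfold pertLagWeight
          rw [sub_eq_add_neg, Real.exp_add]
          ring
      _ ≤ _ := by gcongr

section

open Polynomial

variable {α t : ℝ}

theorem integrableOn_eval_mul_pertLagWeight (hα : 0 < α) (ht : 0 < t) (i : ℕ) (q : ℝ[X]) :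
    IntegrableOn (fun x => q.eval x / x ^ i * pertLagWeight α t x) (Ioi 0) := by
  induction q using Polynomial.induction_on' with
  | add p q hp hq =>
    refine (hp.add hq).congr_fun (fun x _ => ?_) measurableSet_Ioi
    simp only [Pi.add_apply, eval_add]
    ring
  | monomial k c =>
    refine IntegrableOn.congr_fun ((integrableOn_pow_mul_pertLagWeight hα ht i k).const_mul c)
      (fun x _ => ?_) measurableSet_Ioi
    simp only [eval_monomial]
    ring

theorem weightFunctional_add (hα : 0 < α) (ht : 0 < t) (i : ℕ) (p q : ℝ[X]) :
    weightFunctional α t i (p + q) = weightFunctional α t i p + weightFunctional α t i q := by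
  unfold weightFunctional
  rw [← integral_add (integrableOn_eval_mul_pertLagWeight hα ht i p)
    (integrableOn_eval_mul_pertLagWeight hα ht i q)]
  congr 1 with x
  rw [eval_add]
  ring

theorem weightFunctional_C_mul (i : ℕ) (c : ℝ) (q : ℝ[X]) :
    weightFunctional α t i (C c * q) = c * weightFunctional α t i q := by
  unfold weightFunctional
  rw [← integral_const_mul]
  congr 1 with x
  rw [eval_mul, eval_C]
  ring

theorem weightFunctional_X_mul (i : ℕ) (q : ℝ[X]) :
    weightFunctional α t (i + 1) (X * q) = weightFunctional α t i q := by
  unfold weightFunctional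
  refine setIntegral_congr_fun measurableSet_Ioi fun x hx => ?_
  have hx : x ≠ 0 := ne_of_gt hx
  simp only [eval_mul, eval_X]
  field_simp
  ring

theorem weightFunctional_mul_self_pos (hα : 0 < α) (ht : 0 < t) (i : ℕ) {q : ℝ[X]} (hq : q ≠ 0) :
    0 < weightFunctional α t i (q * q) := by
  unfold weightFunctional
  rw [setIntegral_pos_iff_support_of_nonneg_ae]
  · have hsub : Ioi 0 \ {x | q.eval x = 0} ⊆
        Function.support (fun x => (q * q).eval x / x ^ i * pertLagWeight α t x) ∩ Ioi 0 := by
      rintro x ⟨hx : 0 < x, hx0 : q.eval x ≠ 0⟩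
      refine ⟨?_, hx⟩
      have := pertLagWeight_pos (α := α) (t := t) hx
      simp [hx0, hx.ne', this.ne']
    refine lt_of_lt_of_le ?_ (measure_mono hsub)
    have hfin : volume {x | q.eval x = 0} = 0 := by
      refine Set.Finite.measure_zero ?_ _
      exact q.rootSet_finite ℝ |>.subset fun x hx => by
        simpa [mem_rootSet, hq] using hx
    rw [measure_sdiff_null hfin, Real.volume_Ioi]
    exact ENNReal.zero_lt_top
  · refine (ae_restrict_mem measurableSet_Ioi).mono fun x (hx : 0 < x) => ?_
    have := pertLagWeight_pos (α := α) (t := t) hx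
    have := mul_self_nonneg (q.eval x)
    simp only [Pi.zero_apply, eval_mul]
    positivity
  · exact integrableOn_eval_mul_pertLagWeight hα ht i (q * q)

theorem hasDerivAt_pertLagWeight {x : ℝ} (hx : 0 < x) :
    HasDerivAt (pertLagWeight α t) ((α / x - 1 + t / x ^ 2) * pertLagWeight α t x) x := by
  have h1 := Real.hasDerivAt_rpow_const (p := α) (Or.inl hx.ne')
  have h2 : HasDerivAt (fun x : ℝ => -x - t / x) (-1 + t / x ^ 2) x := by
    have := ((hasDerivAt_id x).neg).sub ((hasDerivAt_inv hx.ne').const_mul t)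
    exact this.congr_deriv (by ring)
  refine (h1.mul h2.exp).congr_deriv ?_
  unfold pertLagWeight
  rw [Real.rpow_sub_one hx.ne']
  field_simp
  ring

theorem weightFunctional_derivative (hα : 0 < α) (ht : 0 < t) (q : ℝ[X]) :
    weightFunctional α t 0 (derivative q) = weightFunctional α t 0 q -
      α * weightFunctional α t 1 q - t * weightFunctional α t 2 q := by
  have hI := integrableOn_eval_mul_pertLagWeight (α := α) (t := t) hα ht
  have hderiv : ∀ x ∈ Ioi (0:ℝ), HasDerivAt (fun x => q.eval x * pertLagWeight α t x)
      ((derivative q).eval x / x ^ 0 * pertLagWeight α t x +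
        (α * (q.eval x / x ^ 1 * pertLagWeight α t x) -
          q.eval x / x ^ 0 * pertLagWeight α t x +
          t * (q.eval x / x ^ 2 * pertLagWeight α t x))) x := fun x (hx : 0 < x) => by
    refine ((q.hasDerivAt x).mul (hasDerivAt_pertLagWeight (α := α) (t := t) hx)).congr_deriv ?_
    field_simp
  have hint := (hI 0 (derivative q)).add
    ((((hI 1 q).const_mul α).sub (hI 0 q)).add ((hI 2 q).const_mul t))
  have hcont : ContinuousWithinAt (fun x => q.eval x * pertLagWeight α t x) (Ici 0) 0 := by
    have h0 : q.eval 0 * pertLagWeight α t 0 = 0 := by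
      simp [pertLagWeight, Real.zero_rpow hα.ne']
    rw [ContinuousWithinAt, h0]
    have hlim : Filter.Tendsto (fun x => |q.eval x| * x ^ α) (nhdsWithin 0 (Ici 0)) (nhds 0) := by
      have : ContinuousAt (fun x => |q.eval x| * x ^ α) 0 :=
        q.continuous.abs.continuousAt.mul (Real.continuousAt_rpow_const _ _ (Or.inr hα.le))
      have := this.tendsto.mono_left (nhdsWithin_le_nhds (s := Ici 0))
      simpa [Real.zero_rpow hα.ne'] using this
    refine squeeze_zero_norm' ?_ hlim
    filter_upwards [self_mem_nhdsWithin] with x (hx : 0 ≤ x)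
    rw [norm_mul, Real.norm_eq_abs, Real.norm_eq_abs, pertLagWeight, abs_mul, Real.abs_exp,
      abs_of_nonneg (Real.rpow_nonneg hx α)]
    have : Real.exp (-x - t / x) ≤ 1 := by
      rw [Real.exp_le_one_iff]
      have : 0 ≤ t / x := by positivity
      linarith
    gcongr
    exact mul_le_of_le_one_right (Real.rpow_nonneg hx α) this
  have htop := tendsto_zero_of_hasDerivAt_of_integrableOn_Ioi hderiv hint
    ((hI 0 q).congr_fun (fun x _ => by simp) measurableSet_Ioi)
  have hmain := integral_Ioi_of_hasDerivAt_of_tendsto hcont hderiv hint htop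
  have h0 : pertLagWeight α t 0 = 0 := by simp [pertLagWeight, Real.zero_rpow hα.ne']
  rw [integral_add, integral_add, integral_sub, integral_const_mul, integral_const_mul, h0] at hmain
  · unfold weightFunctional
    linarith
  · exact (hI 1 q).const_mul α
  · exact hI 0 q
  · exact ((hI 1 q).const_mul α).sub (hI 0 q)
  · exact (hI 2 q).const_mul t
  · exact hI 0 (derivative q)
  · exact (((hI 1 q).const_mul α).sub (hI 0 q)).add ((hI 2 q).const_mul t)

/-- `weightFunctional` as a linear map. -/
noncomputable def weightLinearMap (hα : 0 < α) (ht : 0 < t) (i : ℕ) : ℝ[X] →ₗ[ℝ] ℝ where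
  toFun := weightFunctional α t i
  map_add' := weightFunctional_add hα ht i
  map_smul' c q := by
    rw [smul_eq_C_mul, weightFunctional_C_mul, RingHom.id_apply, smul_eq_mul]

end

section

open Polynomial

/-- A sequence of monic orthogonal polynomials `p`, where `J i` plays the role of integration
against `x ^ (-i)` times a weight satisfying the Pearson equation of `pertLagWeight α t`. -/
structure IsPearsonSystem (α t : ℝ) (J : ℕ → ℝ[X] →ₗ[ℝ] ℝ) (p : ℕ → ℝ[X]) (h A B : ℕ → ℝ) :
    Prop where
  map_X_mul : ∀ i q, J (i + 1) (X * q) = J i q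
  map_derivative : ∀ q, J 0 (derivative q) = J 0 q - α * J 1 q - t * J 2 q
  mul_self_pos : ∀ i q, q ≠ 0 → 0 < J i (q * q)
  monic : ∀ n, (p n).Monic
  natDegree : ∀ n, (p n).natDegree = n
  orth : ∀ j k, J 0 (p j * p k) = if j = k then h j else 0
  recurrence : ∀ n, 1 ≤ n → X * p n = p (n + 1) + C (A n) * p n + C (B n) * p (n - 1)

theorem LinearMap.map_C_mul' (J : ℝ[X] →ₗ[ℝ] ℝ) (c : ℝ) (q : ℝ[X]) : J (C c * q) = c * J q := by
  rw [← smul_eq_C_mul, map_smul, smul_eq_mul]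

theorem Polynomial.coeff_X_mul_derivative (q : ℝ[X]) (n : ℕ) :
    (X * derivative q).coeff n = n * q.coeff n := by
  cases n with
  | zero => simp
  | succ n => rw [coeff_X_mul, coeff_derivative]; push_cast; ring

namespace IsPearsonSystem

variable {α t : ℝ} {J : ℕ → ℝ[X] →ₗ[ℝ] ℝ} {p : ℕ → ℝ[X]} {h A B : ℕ → ℝ}

theorem coeff_self (S : IsPearsonSystem α t J p h A B) (n : ℕ) : (p n).coeff n = 1 := by
  have := (S.monic n).coeff_natDegree
  rwa [S.natDegree] at this

theorem coeff_eq_zero (S : IsPearsonSystem α t J p h A B) {n k : ℕ} (hk : n < k) :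
    (p n).coeff k = 0 :=
  coeff_eq_zero_of_natDegree_lt (by rwa [S.natDegree])

theorem h_pos (S : IsPearsonSystem α t J p h A B) (n : ℕ) : 0 < h n := by
  have := S.mul_self_pos 0 (p n) (S.monic n).ne_zero
  rwa [S.orth, if_pos rfl] at this

theorem map_mul_of_coeff (S : IsPearsonSystem α t J p h A B) {n : ℕ} {q : ℝ[X]}
    (hq : ∀ k, n < k → q.coeff k = 0) : J 0 (p n * q) = q.coeff n * h n := by
  suffices ∀ N ≤ n + 1, ∀ q : ℝ[X], (∀ k, N ≤ k → q.coeff k = 0) →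
      J 0 (p n * q) = q.coeff n * h n from this (n + 1) le_rfl q fun k hk => hq k hk
  intro N
  induction N with
  | zero =>
    intro _ q hq
    have : q = 0 := Polynomial.ext fun k => by simpa using hq k (Nat.zero_le k)
    simp [this]
  | succ N ih =>
    intro hN q hq
    have hr := ih (by omega) (q - C (q.coeff N) * p N) fun k hk => by
      rw [coeff_sub, coeff_C_mul]
      rcases hk.eq_or_lt with rfl | hk
      · rw [S.coeff_self]; ring
      · rw [hq k hk, S.coeff_eq_zero hk]; ring
    have e : p n * q = p n * (q - C (q.coeff N) * p N) + C (q.coeff N) * (p n * p N) := by ring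
    rw [e, map_add, hr, LinearMap.map_C_mul', S.orth, coeff_sub, coeff_C_mul]
    rcases (Nat.lt_succ_iff.mp hN).eq_or_lt with rfl | hlt
    · rw [if_pos rfl, S.coeff_self]; ring
    · rw [if_neg (by omega), S.coeff_eq_zero hlt]; ring

theorem map_succ_mul (S : IsPearsonSystem α t J p h A B) (i n : ℕ) (q : ℝ[X]) :
    J (i + 1) (p n * q) = q.coeff 0 * J (i + 1) (p n) + J i (p n * divX q) := by
  nth_rw 1 [← divX_mul_X_add q]
  rw [mul_add, map_add, show p n * (divX q * X) = X * (p n * divX q) by ring, S.map_X_mul,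
    mul_comm (p n) (C _), LinearMap.map_C_mul']
  ring

theorem map_one_mul (S : IsPearsonSystem α t J p h A B) {n : ℕ} {q : ℝ[X]}
    (hq : ∀ k, n + 1 < k → q.coeff k = 0) :
    J 1 (p n * q) = q.coeff 0 * J 1 (p n) + q.coeff (n + 1) * h n := by
  rw [S.map_succ_mul, S.map_mul_of_coeff, coeff_divX]
  intro k hk
  rw [coeff_divX, hq _ (by omega)]

theorem map_two_mul (S : IsPearsonSystem α t J p h A B) {n : ℕ} {q : ℝ[X]}
    (hq : ∀ k, n + 1 < k → q.coeff k = 0) :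
    J 2 (p n * q) = q.coeff 0 * J 2 (p n) + q.coeff 1 * J 1 (p n) := by
  rw [S.map_succ_mul, S.map_one_mul, coeff_divX, coeff_divX, hq (n + 1 + 1) (by omega)]
  · ring
  · intro k hk
    rw [coeff_divX, hq _ (by omega)]

theorem map_two_sq (S : IsPearsonSystem α t J p h A B) (n : ℕ) :
    t * J 2 (p n * p n) = h n - α * J 1 (p n * p n) := by
  have e := S.map_derivative (p n * p n)
  have h0 : J 0 (p n * derivative (p n)) = 0 := by
    rw [S.map_mul_of_coeff, coeff_derivative, S.coeff_eq_zero (by omega)]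
    · ring
    · intro k hk
      rw [coeff_derivative, S.coeff_eq_zero (by omega), zero_mul]
  rw [derivative_mul, mul_comm (derivative (p n)), map_add, h0, S.orth, if_pos rfl] at e
  linarith

theorem map_two_succ_mul (S : IsPearsonSystem α t J p h A B) (n : ℕ) :
    t * J 2 (p (n + 1) * p n) = -((n + 1) * h n) - α * J 1 (p (n + 1) * p n) := by
  have e := S.map_derivative (p (n + 1) * p n)
  have h0 : J 0 (p (n + 1) * derivative (p n)) = 0 := by
    rw [S.map_mul_of_coeff, coeff_derivative, S.coeff_eq_zero (by omega)]
    · ring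
    · intro k hk
      rw [coeff_derivative, S.coeff_eq_zero (by omega), zero_mul]
  have h1 : J 0 (p n * derivative (p (n + 1))) = (n + 1) * h n := by
    rw [S.map_mul_of_coeff, coeff_derivative, S.coeff_self]
    · ring
    · intro k hk
      rw [coeff_derivative, S.coeff_eq_zero (by omega), zero_mul]
  rw [derivative_mul, mul_comm (derivative (p (n + 1))), map_add, h0, h1, S.orth,
    if_neg (by omega)] at e
  linarith

theorem map_X_mul_sq (S : IsPearsonSystem α t J p h A B) (n : ℕ) :
    J 0 (X * (p n * p n)) = (2 * n + 1 + α) * h n + t * J 1 (p n * p n) := by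
  have e := S.map_derivative (X * (p n * p n))
  have h1 : J 0 (p n * (X * derivative (p n))) = n * h n := by
    rw [S.map_mul_of_coeff, coeff_X_mul_derivative, S.coeff_self, mul_one]
    intro k hk
    rw [coeff_X_mul_derivative, S.coeff_eq_zero hk, mul_zero]
  have e1 : derivative (X * (p n * p n)) = p n * p n + p n * (X * derivative (p n)) +
      p n * (X * derivative (p n)) := by
    simp only [derivative_mul, derivative_X]
    ring
  rw [e1, map_add, map_add, h1, S.map_X_mul, S.map_X_mul, S.orth, if_pos rfl] at e
  linarith

theorem map_X_mul_sq_eq_coeff (S : IsPearsonSystem α t J p h A B) (n : ℕ) :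
    J 0 (X * (p n * p n)) = ((X * p n).coeff n - (X * p (n + 1)).coeff (n + 1)) * h n := by
  have h1 := S.map_mul_of_coeff (n := n) (q := X * p n - p (n + 1)) fun k hk => by
    obtain ⟨k, rfl⟩ := Nat.exists_eq_add_one_of_ne_zero (by omega : k ≠ 0)
    rw [coeff_sub, coeff_X_mul]
    rcases (Nat.lt_succ_iff.mp hk).eq_or_lt with rfl | hk
    · rw [S.coeff_self, S.coeff_self, sub_self]
    · rw [S.coeff_eq_zero hk, S.coeff_eq_zero (by omega), sub_self]
  rw [mul_sub, map_sub, S.orth, if_neg (by omega), sub_zero, coeff_sub] at h1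
  rw [coeff_X_mul, ← h1]
  congr 1
  ring

theorem map_mul_X_mul (S : IsPearsonSystem α t J p h A B) (n : ℕ) :
    J 0 (p (n + 1) * (X * p n)) = h (n + 1) := by
  rw [S.map_mul_of_coeff, coeff_X_mul, S.coeff_self, one_mul]
  intro k hk
  obtain ⟨k, rfl⟩ := Nat.exists_eq_add_one_of_ne_zero (by omega : k ≠ 0)
  rw [coeff_X_mul, S.coeff_eq_zero (by omega)]

theorem coeff_X_mul_succ (S : IsPearsonSystem α t J p h A B) (n : ℕ) :
    -(X * p (n + 1)).coeff (n + 1) * h n = h (n + 1) - t * J 1 (p (n + 1) * p n) := by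
  have e := S.map_derivative (X * (p (n + 1) * p n))
  have h0 : J 0 (p (n + 1) * (X * derivative (p n))) = 0 := by
    rw [S.map_mul_of_coeff, coeff_X_mul_derivative, S.coeff_eq_zero (by omega)]
    · ring
    · intro k hk
      rw [coeff_X_mul_derivative, S.coeff_eq_zero (by omega), mul_zero]
  have h1 : J 0 (p n * (X * derivative (p (n + 1)))) = -(p (n + 1)).coeff n * h n := by
    have := S.map_mul_of_coeff (n := n)
      (q := X * derivative (p (n + 1)) - C ((n:ℝ) + 1) * p (n + 1)) fun k hk => by
        rw [coeff_sub, coeff_X_mul_derivative, coeff_C_mul]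
        rcases (Nat.succ_le_iff.mpr hk).eq_or_lt with rfl | hk
        · push_cast; ring
        · rw [S.coeff_eq_zero hk]; ring
    rw [mul_sub, map_sub, mul_left_comm (p n) (C _), LinearMap.map_C_mul', S.orth,
      if_neg (by omega), mul_zero, sub_zero, coeff_sub, coeff_X_mul_derivative, coeff_C_mul] at this
    rw [this]
    ring
  have e1 : derivative (X * (p (n + 1) * p n)) = p (n + 1) * p n +
      p n * (X * derivative (p (n + 1))) + p (n + 1) * (X * derivative (p n)) := by
    simp only [derivative_mul, derivative_X]
    ring
  rw [e1, map_add, map_add, h1, h0, S.map_X_mul, S.map_X_mul, S.orth, if_neg (by omega),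
    mul_left_comm X, S.map_mul_X_mul] at e
  rw [coeff_X_mul]
  linarith

theorem A_mul (S : IsPearsonSystem α t J p h A B) {n : ℕ} (hn : 1 ≤ n) :
    A n * h n = (2 * n + 1 + α) * h n + t * J 1 (p n * p n) := by
  rw [← S.map_X_mul_sq, mul_left_comm, S.recurrence n hn, mul_add, mul_add, map_add, map_add,
    mul_left_comm, LinearMap.map_C_mul', mul_left_comm, LinearMap.map_C_mul', S.orth, S.orth,
    S.orth, if_neg (by omega), if_pos rfl, if_neg (by omega)]
  ring

theorem B_succ_mul (S : IsPearsonSystem α t J p h A B) (n : ℕ) :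
    B (n + 1) * h n = h (n + 1) := by
  rw [← S.map_mul_X_mul, mul_left_comm, mul_comm (p (n + 1)), mul_left_comm,
    S.recurrence (n + 1) (by omega), mul_add, mul_add, map_add, map_add,
    mul_left_comm, LinearMap.map_C_mul', mul_left_comm, LinearMap.map_C_mul', S.orth, S.orth,
    Nat.add_sub_cancel, S.orth, if_neg (by omega), if_neg (by omega), if_pos rfl]
  ring

theorem h_succ_eq (S : IsPearsonSystem α t J p h A B) (n : ℕ) :
    h (n + 1) = J 1 (p (n + 2) * p (n + 1)) + A (n + 1) * J 1 (p (n + 1) * p (n + 1)) +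
      B (n + 1) * J 1 (p (n + 1) * p n) := by
  have e : J 1 (X * (p (n + 1) * p (n + 1))) = h (n + 1) := by
    rw [S.map_X_mul, S.orth, if_pos rfl]
  rw [← e, mul_left_comm, S.recurrence (n + 1) (by omega), mul_add, mul_add, map_add, map_add,
    mul_left_comm, LinearMap.map_C_mul', mul_left_comm, LinearMap.map_C_mul', Nat.add_sub_cancel,
    mul_comm (p (n + 1)) (p (n + 1 + 1))]

theorem map_one_sq (S : IsPearsonSystem α t J p h A B) (n : ℕ) :
    J 1 (p n * p n) = (p n).coeff 0 * J 1 (p n) := by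
  rw [S.map_one_mul fun k hk => S.coeff_eq_zero (by omega), S.coeff_eq_zero n.lt_succ_self]
  ring

theorem map_one_succ_mul (S : IsPearsonSystem α t J p h A B) (n : ℕ) :
    J 1 (p (n + 1) * p n) = (p n).coeff 0 * J 1 (p (n + 1)) := by
  rw [S.map_one_mul fun k hk => S.coeff_eq_zero (by omega),
    S.coeff_eq_zero (show n < n + 1 + 1 by omega)]
  ring

theorem map_one_succ_mul' (S : IsPearsonSystem α t J p h A B) (n : ℕ) :
    J 1 (p (n + 1) * p n) = (p (n + 1)).coeff 0 * J 1 (p n) + h n := by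
  rw [mul_comm, S.map_one_mul fun k hk => S.coeff_eq_zero hk, S.coeff_self, one_mul]

theorem map_one_mul_sub (S : IsPearsonSystem α t J p h A B) (n : ℕ) :
    J 1 (p (n + 1) * p n) * (J 1 (p (n + 1) * p n) - h n) =
      J 1 (p (n + 1) * p (n + 1)) * J 1 (p n * p n) := by
  rw [S.map_one_sq, S.map_one_sq]
  nth_rw 1 [S.map_one_succ_mul]
  rw [S.map_one_succ_mul']
  ring

theorem map_one_map_two (S : IsPearsonSystem α t J p h A B) (n : ℕ) :
    J 1 (p (n + 1) * p (n + 1)) * J 2 (p n * p n) + J 1 (p n * p n) * J 2 (p (n + 1) * p (n + 1)) =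
      J 2 (p (n + 1) * p n) * (2 * J 1 (p (n + 1) * p n) - h n) := by
  have f1 := S.map_two_mul (n := n + 1) (q := p n) fun k hk => S.coeff_eq_zero (by omega)
  have f2 := S.map_two_mul (n := n) (q := p (n + 1)) fun k hk => S.coeff_eq_zero hk
  have f3 := S.map_two_mul (n := n + 1) (q := p (n + 1)) fun k hk => S.coeff_eq_zero (by omega)
  have f4 := S.map_two_mul (n := n) (q := p n) fun k hk => S.coeff_eq_zero (by omega)
  rw [mul_comm] at f2
  have g : 2 * J 1 (p (n + 1) * p n) - h n =
      (p n).coeff 0 * J 1 (p (n + 1)) + (p (n + 1)).coeff 0 * J 1 (p n) := by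
    linarith [S.map_one_succ_mul n, S.map_one_succ_mul' n]
  rw [g, mul_add, S.map_one_sq, S.map_one_sq, f3, f4]
  nth_rw 1 [f2]
  rw [f1]
  ring

end IsPearsonSystem

end

section

open Polynomial

/-- `t J₁(pₙ²) / hₙ`. -/
noncomputable def diagRatio (t : ℝ) (J : ℕ → ℝ[X] →ₗ[ℝ] ℝ) (p : ℕ → ℝ[X]) (h : ℕ → ℝ) (n : ℕ) : ℝ :=
  t * J 1 (p n * p n) / h n

/-- `t J₁(pₙ₊₁ pₙ) / hₙ`. -/
noncomputable def offDiagRatio (t : ℝ) (J : ℕ → ℝ[X] →ₗ[ℝ] ℝ) (p : ℕ → ℝ[X]) (h : ℕ → ℝ)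
    (n : ℕ) : ℝ :=
  t * J 1 (p (n + 1) * p n) / h n

namespace IsPearsonSystem

variable {α t : ℝ} {J : ℕ → ℝ[X] →ₗ[ℝ] ℝ} {p : ℕ → ℝ[X]} {h A B : ℕ → ℝ}

theorem diagRatio_pos (S : IsPearsonSystem α t J p h A B) (ht : 0 < t) (n : ℕ) :
    0 < diagRatio t J p h n :=
  div_pos (mul_pos ht (S.mul_self_pos 1 _ (S.monic n).ne_zero)) (S.h_pos n)

theorem diagRatio_le (S : IsPearsonSystem α t J p h A B) (hα : 0 < α) (ht : 0 < t) (n : ℕ) :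
    diagRatio t J p h n ≤ t / α := by
  unfold diagRatio
  rw [div_le_div_iff₀ (S.h_pos n) hα, mul_assoc]
  have h1 := S.map_two_sq n
  have h2 := mul_pos ht (S.mul_self_pos 2 _ (S.monic n).ne_zero)
  gcongr
  linarith

theorem A_eq (S : IsPearsonSystem α t J p h A B) {n : ℕ} (hn : 1 ≤ n) :
    A n = 2 * n + 1 + α + diagRatio t J p h n := by
  have := (S.h_pos n).ne'
  unfold diagRatio
  field_simp
  linarith [S.A_mul hn]

theorem neg_coeff_X_mul (S : IsPearsonSystem α t J p h A B) (n : ℕ) :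
    -(X * p n).coeff n = n ^ 2 + α * n + ∑ j ∈ Finset.range n, diagRatio t J p h j := by
  induction n with
  | zero => simp
  | succ n ih =>
    have h0 := (S.h_pos n).ne'
    have h1 : (X * p n).coeff n - (X * p (n + 1)).coeff (n + 1) =
        2 * n + 1 + α + diagRatio t J p h n := by
      unfold diagRatio
      field_simp
      linarith [S.map_X_mul_sq n, S.map_X_mul_sq_eq_coeff n]
    rw [Finset.sum_range_succ]
    push_cast
    linarith

theorem B_succ_eq (S : IsPearsonSystem α t J p h A B) (n : ℕ) :
    B (n + 1) = (n + 1 : ℕ) ^ 2 + α * (n + 1 : ℕ) + offDiagRatio t J p h n +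
      ∑ j ∈ Finset.range (n + 1), diagRatio t J p h j := by
  have h0 := (S.h_pos n).ne'
  have h1 : -(X * p (n + 1)).coeff (n + 1) = B (n + 1) - offDiagRatio t J p h n := by
    unfold offDiagRatio
    field_simp
    linarith [S.coeff_X_mul_succ n, S.B_succ_mul n]
  linarith [S.neg_coeff_X_mul (n + 1)]

theorem B_succ_pos (S : IsPearsonSystem α t J p h A B) (n : ℕ) : 0 < B (n + 1) := by
  have := S.h_pos (n + 1)
  rw [← S.B_succ_mul] at this
  exact pos_of_mul_pos_left this (S.h_pos n).le

theorem offDiagRatio_add (S : IsPearsonSystem α t J p h A B) (n : ℕ) :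
    offDiagRatio t J p h (n + 1) + offDiagRatio t J p h n =
      t - A (n + 1) * diagRatio t J p h (n + 1) := by
  have h0 := (S.h_pos n).ne'
  have h1 := (S.h_pos (n + 1)).ne'
  have h2 : offDiagRatio t J p h n = t * (B (n + 1) * J 1 (p (n + 1) * p n)) / h (n + 1) := by
    unfold offDiagRatio
    rw [← S.B_succ_mul] at h1 ⊢
    have := left_ne_zero_of_mul h1
    field_simp
  rw [h2]
  unfold offDiagRatio diagRatio
  field_simp
  linear_combination -t * S.h_succ_eq n

theorem offDiagRatio_mul_sub (S : IsPearsonSystem α t J p h A B) (n : ℕ) :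
    offDiagRatio t J p h n * (offDiagRatio t J p h n - t) =
      B (n + 1) * (diagRatio t J p h (n + 1) * diagRatio t J p h n) := by
  have h0 := (S.h_pos n).ne'
  have h1 := (B_succ_pos S n).ne'
  unfold offDiagRatio diagRatio
  rw [← S.B_succ_mul]
  field_simp
  linear_combination t ^ 2 * S.map_one_mul_sub n

theorem B_succ_mul_add (S : IsPearsonSystem α t J p h A B) (ht : 0 < t) (n : ℕ) :
    B (n + 1) * (diagRatio t J p h (n + 1) + diagRatio t J p h n) =
      t * (n + 1 : ℕ) - (2 * (n + 1 : ℕ) + α) * offDiagRatio t J p h n := by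
  have h0 := (S.h_pos n).ne'
  have h1 := (B_succ_pos S n).ne'
  have hB := S.B_succ_mul n
  have e := S.map_one_map_two n
  have e1 := S.map_two_sq n
  have e2 := S.map_two_sq (n + 1)
  have e3 := S.map_two_succ_mul n
  have e4 := S.map_one_mul_sub n
  unfold offDiagRatio diagRatio
  rw [← hB] at e2 ⊢
  set x := J 1 (p (n + 1) * p (n + 1))
  set y := J 1 (p n * p n)
  set z := J 1 (p (n + 1) * p n)
  set x' := J 2 (p (n + 1) * p (n + 1))
  set y' := J 2 (p n * p n)
  set z' := J 2 (p (n + 1) * p n)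
  push_cast
  have key : x * (h n - α * y) + y * (B (n + 1) * h n - α * x) =
      (-((n + 1) * h n) - α * z) * (2 * z - h n) := by
    rw [← e1, ← e2, ← e3]
    linear_combination t * e
  have key2 : h n * (x + B (n + 1) * y) = h n * ((n + 1) * h n - (2 * (n + 1) + α) * z) := by
    linear_combination key - 2 * α * e4
  have key3 := mul_left_cancel₀ h0 key2
  field_simp
  linear_combination key3

theorem offDiagRatio_neg (S : IsPearsonSystem α t J p h A B) (hα : 0 < α) (ht : 0 < t) (n : ℕ) :
    offDiagRatio t J p h n < 0 := by
  have ha := S.diagRatio_pos ht n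
  have ha' := S.diagRatio_pos ht (n + 1)
  have hB := S.B_succ_pos n
  have e1 := S.offDiagRatio_mul_sub n
  have e2 := S.B_succ_mul_add ht n
  have p1 : 0 < offDiagRatio t J p h n * (offDiagRatio t J p h n - t) := by rw [e1]; positivity
  have p2 : 0 < t * (n + 1 : ℕ) - (2 * (n + 1 : ℕ) + α) * offDiagRatio t J p h n := by
    rw [← e2]; positivity
  by_contra! hb
  have hbt : 0 < offDiagRatio t J p h n - t := pos_of_mul_pos_right p1 hb
  have hN : (0:ℝ) < (n + 1 : ℕ) := by positivity
  nlinarith [mul_pos hN hbt, mul_pos hN ht, mul_nonneg hα.le hb]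

theorem isPositiveSolution (S : IsPearsonSystem α t J p h A B) (hα : 0 < α) (ht : 0 < t) :
    IsPositiveSolution α t (diagRatio t J p h) (fun n => t / 2 - offDiagRatio t J p h (n - 1)) where
  a_pos := S.diagRatio_pos ht
  m_gt n _ := by linarith [S.offDiagRatio_neg hα ht (n - 1)]
  sum_m n hn := by
    obtain ⟨n, rfl⟩ := Nat.exists_eq_add_of_le' hn
    have := S.offDiagRatio_add n
    rw [S.A_eq hn] at this
    simp only [Nat.add_sub_cancel]
    linear_combination -this
  sum_inv_a n := by
    have ha := (S.diagRatio_pos ht n).ne'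
    have ha' := (S.diagRatio_pos ht (n + 1)).ne'
    have e1 := S.offDiagRatio_mul_sub n
    have e2 := S.B_succ_mul_add ht n
    simp only [Nat.add_sub_cancel]
    have e : (t / 2 - offDiagRatio t J p h n) ^ 2 - t ^ 2 / 4 =
        B (n + 1) * (diagRatio t J p h (n + 1) * diagRatio t J p h n) := by
      rw [← e1]; ring
    rw [e]
    calc _ = B (n + 1) * (diagRatio t J p h (n + 1) + diagRatio t J p h n) := by
          field_simp
          ring
      _ = _ := by
        rw [e2]
        push_cast
        ring

end IsPearsonSystem

end

section

open Polynomial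

variable {α t : ℝ}

theorem pertLagWeight_le_of_le {s τ x : ℝ} (h : s ≤ τ) (hx : 0 < x) :
    pertLagWeight α τ x ≤ pertLagWeight α s x := by
  unfold pertLagWeight
  gcongr

theorem hasDerivAt_weightFunctional (hα : 0 < α) (ht : 0 < t) (q : ℝ[X]) :
    HasDerivAt (fun τ => weightFunctional α τ 0 q) (-weightFunctional α t 1 q) t := by
  have h2 := half_pos ht
  have hmem : Ioi (t / 2) ∈ nhds t := Ioi_mem_nhds (by linarith)
  have key := hasDerivAt_integral_of_dominated_loc_of_deriv_le
    (μ := volume.restrict (Ioi (0:ℝ)))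
    (F := fun τ x => q.eval x / x ^ 0 * pertLagWeight α τ x)
    (F' := fun τ x => -(q.eval x / x ^ 1 * pertLagWeight α τ x))
    (bound := fun x => ‖q.eval x / x ^ 1 * pertLagWeight α (t / 2) x‖) (x₀ := t) hmem
    (Filter.eventually_of_mem hmem fun τ hτ =>
      (integrableOn_eval_mul_pertLagWeight hα (h2.trans hτ) 0 q).aestronglyMeasurable)
    (integrableOn_eval_mul_pertLagWeight hα ht 0 q)
    (integrableOn_eval_mul_pertLagWeight hα ht 1 q).aestronglyMeasurable.neg
    ((ae_restrict_mem measurableSet_Ioi).mono fun x (hx : 0 < x) τ (hτ : t / 2 < τ) => by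
      rw [norm_neg, norm_mul, norm_mul, Real.norm_of_nonneg (pertLagWeight_pos hx).le,
        Real.norm_of_nonneg (pertLagWeight_pos hx).le]
      gcongr
      exact pertLagWeight_le_of_le hτ.le hx)
    (integrableOn_eval_mul_pertLagWeight hα h2 1 q).norm
    ((ae_restrict_mem measurableSet_Ioi).mono fun x (hx : 0 < x) τ _ => by
      have h1 : HasDerivAt (fun τ : ℝ => -x - τ / x) (-(1 / x)) τ :=
        ((hasDerivAt_id τ).div_const x).const_sub (-x)
      refine ((h1.exp.const_mul (x ^ α)).const_mul (q.eval x / x ^ 0)).congr_deriv ?_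
      unfold pertLagWeight
      field_simp)
  refine key.2.congr_deriv ?_
  rw [integral_neg]
  rfl

end

theorem hasDerivAt_det_of_eq_diagonal {ι : Type*} [Fintype ι] [DecidableEq ι]
    {N : ℝ → Matrix ι ι ℝ} {N' : Matrix ι ι ℝ} {d : ι → ℝ} {t : ℝ}
    (hN : ∀ i j, HasDerivAt (fun τ => N τ i j) (N' i j) t) (hd : N t = Matrix.diagonal d) :
    HasDerivAt (fun τ => (N τ).det) (∑ i, (∏ j ∈ Finset.univ.erase i, d j) * N' i i) t := by
  simp only [Matrix.det_apply']
  have h1 := HasDerivAt.fun_sum (u := Finset.univ) fun (σ : Equiv.Perm ι) _ =>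
    (HasDerivAt.fun_finsetProd (u := Finset.univ) fun i _ => hN (σ i) i).const_mul
      ((Equiv.Perm.sign σ : ℤ) : ℝ)
  refine h1.congr_deriv ?_
  rw [Finset.sum_eq_single 1]
  · simp [hd]
  · intro σ _ hσ
    rw [Finset.sum_eq_zero, mul_zero]
    intro i _
    obtain ⟨j, hj, hji⟩ : ∃ j, σ j ≠ j ∧ j ≠ i := by
      obtain ⟨j, hj⟩ : ∃ j, σ j ≠ j := by
        by_contra! h
        exact hσ (Equiv.ext h)
      by_cases hji : j = i
      · subst hji
        exact ⟨σ j, fun h => hj (σ.injective h), hj⟩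
      · exact ⟨j, hj, hji⟩
    rw [Finset.prod_eq_zero (Finset.mem_erase.mpr ⟨hji, Finset.mem_univ j⟩), zero_smul]
    rw [hd, Matrix.diagonal_apply_ne _ hj]
  · simp

open Polynomial in
theorem hankelDet_eq_det {α τ : ℝ} (hα : 0 < α) (hτ : 0 < τ) {p : ℕ → ℝ[X]}
    (hmonic : ∀ n, (p n).Monic) (hdeg : ∀ n, (p n).natDegree = n) (n : ℕ) :
    hankelDet α n τ =
      (Matrix.of fun j k : Fin n => weightFunctional α τ 0 (p j * p k)).det := by
  set M := Matrix.of fun j k : Fin n => pertLagMoment α τ (j.1 + k.1) with hM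
  set K := Matrix.of fun j k : Fin n => (p j).coeff k with hK
  have hKdet : K.det = 1 := by
    rw [Matrix.det_of_isLowerTriangular]
    · refine Finset.prod_eq_one fun i _ => ?_
      have := (hmonic i).coeff_natDegree
      rwa [hdeg] at this
    · intro i j (hij : i < j)
      exact coeff_eq_zero_of_natDegree_lt (by rwa [hdeg])
  have hp : ∀ j : Fin n, p j = ∑ a : Fin n, C (K j a) * X ^ (a:ℕ) := fun j => by
    change p j = ∑ a : Fin n, C ((p j).coeff a) * X ^ (a:ℕ)
    rw [Fin.sum_univ_eq_sum_range (fun a => C ((p j).coeff a) * X ^ a)]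
    exact as_sum_range_C_mul_X_pow' _ (by rw [hdeg]; exact j.2)
  have hmom : ∀ k, weightLinearMap hα hτ 0 (X ^ k) = pertLagMoment α τ k := fun k => by
    simp [weightLinearMap, weightFunctional, pertLagMoment]
  have e : (Matrix.of fun j k : Fin n => weightFunctional α τ 0 (p j * p k)) =
      K * M * K.transpose := by
    ext j k
    change weightLinearMap hα hτ 0 (p j * p k) = _
    rw [hp j, hp k, Finset.sum_mul_sum, map_sum, Matrix.mul_assoc, Matrix.mul_apply]
    refine Finset.sum_congr rfl fun a _ => ?_
    rw [map_sum, Matrix.mul_apply, Finset.mul_sum]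
    refine Finset.sum_congr rfl fun b _ => ?_
    rw [show C (K j a) * X ^ (a:ℕ) * (C (K k b) * X ^ (b:ℕ)) =
      C (K j a) * (C (K k b) * X ^ (a + b : ℕ)) by ring, LinearMap.map_C_mul',
      LinearMap.map_C_mul', hmom, Matrix.transpose_apply, hM, Matrix.of_apply]
    ring
  rw [e, Matrix.det_mul, Matrix.det_mul, Matrix.det_transpose, hKdet, one_mul, mul_one]
  rfl

open Polynomial in
theorem Hlog_eq_neg_sum {α t : ℝ} (hα : 0 < α) (ht : 0 < t) {p : ℕ → ℝ[X]} {h A B : ℕ → ℝ}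
    (S : IsPearsonSystem α t (weightLinearMap hα ht) p h A B) (n : ℕ) :
    Hlog α n t = -∑ j ∈ Finset.range n, diagRatio t (weightLinearMap hα ht) p h j := by
  set N : ℝ → Matrix (Fin n) (Fin n) ℝ :=
    fun τ => Matrix.of fun j k => weightFunctional α τ 0 (p j * p k) with hN
  have hdiag : N t = Matrix.diagonal fun j : Fin n => h j := by
    ext j k
    change weightLinearMap hα ht 0 (p j * p k) = _
    rw [S.orth, Matrix.diagonal_apply]
    simp only [Fin.ext_iff]
  have hdet : (N t).det = ∏ j : Fin n, h j := by rw [hdiag, Matrix.det_diagonal]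
  have hdet0 : (N t).det ≠ 0 := by
    rw [hdet]
    exact Finset.prod_ne_zero_iff.mpr fun j _ => (S.h_pos j).ne'
  have hder := (hasDerivAt_det_of_eq_diagonal (N := N)
    (N' := Matrix.of fun j k : Fin n => -weightFunctional α t 1 (p j * p k))
    (fun j k => hasDerivAt_weightFunctional hα ht (p j * p k)) hdiag).log hdet0
  have hev : (fun τ => Real.log (hankelDet α n τ)) =ᶠ[nhds t] fun τ => Real.log (N τ).det := by
    filter_upwards [Ioi_mem_nhds ht] with τ hτ
    rw [hankelDet_eq_det hα hτ S.monic S.natDegree]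
  rw [Hlog, hev.deriv_eq, hder.deriv, hdet, Finset.sum_div, Finset.mul_sum,
    ← Finset.sum_neg_distrib, ← Fin.sum_univ_eq_sum_range]
  refine Finset.sum_congr rfl fun j _ => ?_
  have h1 := (S.h_pos j).ne'
  have h2 : (∏ i ∈ Finset.univ.erase j, h i) ≠ 0 :=
    Finset.prod_ne_zero_iff.mpr fun i _ => (S.h_pos i).ne'
  rw [← Finset.mul_prod_erase Finset.univ (fun i : Fin n => h i) (Finset.mem_univ j)]
  change t * ((∏ i ∈ Finset.univ.erase j, h i) * -weightFunctional α t 1 (p j * p j) / _) =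
    -(t * weightFunctional α t 1 (p j * p j) / h j)
  field_simp

theorem isPearsonSystem_of_orthogonal {α t : ℝ} (hα : 0 < α) (ht : 0 < t)
    {P : ℕ → ℝ → ℝ} {p : ℕ → Polynomial ℝ} {h A B : ℕ → ℝ}
    (hp : ∀ m, (p m).Monic ∧ (p m).natDegree = m ∧ ∀ x, P m x = (p m).eval x)
    (horth : ∀ j k, (∫ x in Ioi (0:ℝ), P j x * P k x * pertLagWeight α t x)
      = if j = k then h j else 0)
    (hrec : ∀ m, 1 ≤ m → ∀ x, x * P m x = P (m + 1) x + A m * P m x + B m * P (m - 1) x) :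
    IsPearsonSystem α t (weightLinearMap hα ht) p h A B where
  map_X_mul := weightFunctional_X_mul
  map_derivative := weightFunctional_derivative hα ht
  mul_self_pos i _ hq := weightFunctional_mul_self_pos hα ht i hq
  monic n := (hp n).1
  natDegree n := (hp n).2.1
  orth j k := by
    rw [← horth]
    refine integral_congr_ae (Filter.Eventually.of_forall fun x => ?_)
    simp only [pow_zero, div_one, Polynomial.eval_mul, (hp _).2.2]
  recurrence n hn := by
    refine Polynomial.funext fun x => ?_
    have := hrec n hn x
    simp only [(hp _).2.2] at this
    simpa using this

theorem rpow_const_identities {t κ : ℝ} (ht : 0 < t)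
    (hκ : κ = t ^ ((2:ℝ) / 3) / (2:ℝ) ^ ((1:ℝ) / 3)) :
    κ ^ 3 = t ^ 2 / 2 ∧ (2:ℝ) ^ (-(4:ℝ) / 3) * t ^ ((2:ℝ) / 3) = κ / 2 ∧
      (2 * t) ^ ((2:ℝ) / 3) = 2 * κ := by
  have h2 := rpow_third_pow (s := 2) (by norm_num)
  have h3 := rpow_third_pow ht.le
  have e1 : (2:ℝ) ^ (-(4:ℝ) / 3) = (2 * (2:ℝ) ^ ((1:ℝ) / 3))⁻¹ := by
    rw [show -(4:ℝ) / 3 = -(1 + 1 / 3) by norm_num, Real.rpow_neg (by norm_num),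
      Real.rpow_add (by norm_num), Real.rpow_one]
  have hpos : (0:ℝ) < (2:ℝ) ^ ((1:ℝ) / 3) := by positivity
  rw [Real.mul_rpow (by norm_num) ht.le, e1, hκ, rpow_two_thirds (by norm_num : (0:ℝ) ≤ 2),
    rpow_two_thirds ht.le]
  set u := (2:ℝ) ^ ((1:ℝ) / 3)
  set v := t ^ ((1:ℝ) / 3)
  refine ⟨?_, by field_simp, ?_⟩
  · rw [← h3, div_pow, h2]; ring
  · rw [← h2]; field_simp

/-- Fix `α > 0` and `t > 0`. As `n → ∞`:
`α_n(t) = 2n + α + 1 + (t^{2/3}/2^{1/3}) n^{-1/3} + O(n^{-2/3})`,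
`β_n(t) = n² + αn + 2^{-4/3} t^{2/3} n^{2/3} + O(n^{1/3})`, and
`H_n(t) = -(3/4)(2t)^{2/3} n^{2/3} + O(n^{1/3})`. -/
theorem large_s_transition_asymptotics
    (α t : ℝ) (hα : 0 < α) (ht : 0 < t)
    (P : ℕ → ℝ → ℝ → ℝ) (h : ℕ → ℝ → ℝ) (A B : ℕ → ℝ → ℝ)
    (hmonic : ∀ m : ℕ, ∀ τ > (0:ℝ), ∃ p : Polynomial ℝ,
      p.Monic ∧ p.natDegree = m ∧ ∀ x, P m τ x = p.eval x)
    (horth : ∀ j k : ℕ, ∀ τ > (0:ℝ),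
      (∫ x in Ioi (0:ℝ), P j τ x * P k τ x * pertLagWeight α τ x)
        = if j = k then h j τ else 0)
    (hpos : ∀ j : ℕ, ∀ τ > (0:ℝ), 0 < h j τ)
    (hrec : ∀ m : ℕ, 1 ≤ m → ∀ τ > (0:ℝ), ∀ x : ℝ,
      x * P m τ x = P (m + 1) τ x + A m τ * P m τ x + B m τ * P (m - 1) τ x) :
    ∃ C > (0:ℝ), ∃ N : ℕ, ∀ n ≥ N,
      (|A n t - (2 * (n : ℝ) + α + 1)
          - (t ^ ((2:ℝ) / 3) / (2:ℝ) ^ ((1:ℝ) / 3)) * (n : ℝ) ^ (-(1:ℝ) / 3)|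
        ≤ C * (n : ℝ) ^ (-(2:ℝ) / 3)) ∧
      (|B n t - (n : ℝ) ^ 2 - α * n
          - (2:ℝ) ^ (-(4:ℝ) / 3) * t ^ ((2:ℝ) / 3) * (n : ℝ) ^ ((2:ℝ) / 3)|
        ≤ C * (n : ℝ) ^ ((1:ℝ) / 3)) ∧
      (|Hlog α n t + (3 / 4) * (2 * t) ^ ((2:ℝ) / 3) * (n : ℝ) ^ ((2:ℝ) / 3)|
        ≤ C * (n : ℝ) ^ ((1:ℝ) / 3)) := by
  choose p hp using fun m => hmonic m t ht
  have S := isPearsonSystem_of_orthogonal hα ht hp (horth · · t ht) (hrec · · t ht)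
  set a := diagRatio t (weightLinearMap hα ht) p (h · t)
  set b := offDiagRatio t (weightLinearMap hα ht) p (h · t)
  obtain ⟨κ, hκdef⟩ : ∃ κ, κ = t ^ ((2:ℝ) / 3) / (2:ℝ) ^ ((1:ℝ) / 3) := ⟨_, rfl⟩
  have hκ : 0 < κ := by rw [hκdef]; positivity
  obtain ⟨hκ3, c1, c2⟩ := rpow_const_identities ht hκdef
  obtain ⟨C, hC, N, hN1, hN⟩ :=
    (S.isPositiveSolution hα ht).asymptotics hα ht hκ hκ3 (S.diagRatio_le hα ht)
  obtain ⟨C', hC', hN'⟩ := sum_asymptotics hN1 hC hκ fun n hn => (hN n hn).1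
  refine ⟨C + C' + t / 2, by positivity, N, fun n hn => ?_⟩
  obtain ⟨h1, h2⟩ := hN n hn
  have h3 := hN' n hn
  have hn1 : 1 ≤ n := hN1.trans hn
  have hρ1 : 1 ≤ (n:ℝ) ^ ((1:ℝ) / 3) :=
    Real.one_le_rpow (by exact_mod_cast hn1) (by norm_num)
  have hA := S.A_eq hn1
  have hB := S.B_succ_eq (n - 1)
  rw [Nat.sub_add_cancel hn1] at hB
  rw [← hκdef, c1, c2, Hlog_eq_neg_sum hα ht S, hA, hB, rpow_neg_third (by positivity),
    rpow_two_thirds (by positivity), rpow_neg_two_thirds (by positivity)]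
  set ρ := (n:ℝ) ^ ((1:ℝ) / 3)
  have hρ : 0 < ρ := by linarith
  have hκρ : κ * ρ⁻¹ = κ / ρ := rfl
  have hρ2 : 1 ≤ ρ ^ 2 := one_le_pow₀ hρ1
  have hCρ : 0 ≤ C * ρ := by positivity
  have hCρ' : 0 ≤ C' * ρ := by positivity
  have htρ : t / 2 ≤ t / 2 * ρ := le_mul_of_one_le_right (by positivity) hρ1
  rw [abs_le] at h2 h3
  refine ⟨?_, ?_, ?_⟩
  · rw [show 2 * (n:ℝ) + 1 + α + a n - (2 * n + α + 1) - κ * ρ⁻¹ = a n - κ / ρ by ring]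
    refine h1.trans ?_
    rw [div_eq_mul_inv]
    gcongr
    linarith
  · rw [abs_le]
    constructor <;> linarith
  · rw [abs_le]
    constructor <;> linarith
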